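/- arXiv:math/9504205 — 3 statements merged into one kernel-verified Lean document; each statement's English description precedes it below -/
import Mathlib

section
/- Let X be a Banach space, let E = span{x_0, …, x_m} be a finite dimensional subspace of X, and let 𝒴 be a total linear subspace of X*. For each ε > 0 there exists η > 0 with the following property: if y* ∈ X* satisfies |y*(x_i)| < η for each 0 ≤ i ≤ m, then there exists x* ∈ X* vanishing on E, with ‖x*‖ = 0 or ‖x*‖ = ‖y*‖, such that ‖x* − y*‖ < ε; furthermore, if y* ∈ 𝒴 then x* can be taken to lie in 𝒴. -/
open Filter Topology

/-- If the subspace `𝒴` of the dual is total, then on finitely many points every continuous linear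
functional agrees with some member of `𝒴`. -/
theorem exists_mem_eq_on_of_total {X ι : Type*} [NormedAddCommGroup X] [NormedSpace ℝ X]
    [Fintype ι] (x : ι → X) (𝒴 : Submodule ℝ (X →L[ℝ] ℝ))
    (h𝒴 : ∀ v : X, (∀ ψ ∈ 𝒴, ψ v = 0) → v = 0) (y : X →L[ℝ] ℝ) :
    ∃ ψ ∈ 𝒴, ∀ i, ψ (x i) = y (x i) := by
  classical
  let L : (X →L[ℝ] ℝ) →ₗ[ℝ] (ι → ℝ) :=
    LinearMap.pi fun i => (ContinuousLinearMap.apply ℝ ℝ (x i)).toLinearMap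
  have hL : ∀ ψ i, L ψ i = ψ (x i) := fun _ _ => rfl
  suffices h : L y ∈ 𝒴.map L by
    obtain ⟨ψ, hψ, hψy⟩ := h
    exact ⟨ψ, hψ, fun i => congrFun hψy i⟩
  by_contra hy
  obtain ⟨f, hfy, hf⟩ := Submodule.exists_le_ker_of_notMem hy
  have hfL : ∀ ψ : X →L[ℝ] ℝ, f (L ψ) = ψ (∑ i, f (Pi.single i 1) • x i) := fun ψ => by
    rw [LinearMap.pi_apply_eq_sum_univ f (L ψ), map_sum]
    refine Finset.sum_congr rfl fun i _ => ?_
    simp only [hL, map_smul, smul_eq_mul, mul_comm]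
    congr 2
    ext j
    simp [Pi.single_apply, eq_comm]
  have h0 := h𝒴 _ fun ψ hψ => (hfL ψ).symm.trans (hf (Submodule.mem_map_of_mem hψ))
  exact hfy (by rw [hfL, h0, map_zero])

/-- A bounded linear choice of the functionals in `exists_mem_eq_on_of_total`, depending only on
the values at the given points. -/
theorem exists_continuousLinearMap_interpolating {X ι : Type*} [NormedAddCommGroup X]
    [NormedSpace ℝ X] [Fintype ι] (x : ι → X) (𝒴 : Submodule ℝ (X →L[ℝ] ℝ))
    (h𝒴 : ∀ v : X, (∀ ψ ∈ 𝒴, ψ v = 0) → v = 0) :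
    ∃ S : (ι → ℝ) →L[ℝ] (X →L[ℝ] ℝ), (∀ c, S c ∈ 𝒴) ∧
      ∀ (y : X →L[ℝ] ℝ) i, S (fun j => y (x j)) (x i) = y (x i) := by
  let L : 𝒴 →ₗ[ℝ] (ι → ℝ) :=
    (LinearMap.pi fun i => (ContinuousLinearMap.apply ℝ ℝ (x i)).toLinearMap).comp 𝒴.subtype
  obtain ⟨R, hR⟩ := L.rangeRestrict.exists_rightInverse_of_surjective L.range_rangeRestrict
  obtain ⟨T, hT⟩ := LinearMap.exists_extend (K := ℝ) (V := ι → ℝ) (V' := 𝒴) (p := L.range) R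
  refine ⟨LinearMap.toContinuousLinearMap (𝒴.subtype ∘ₗ T), fun c => (T c).2, fun y i => ?_⟩
  obtain ⟨ψ, hψ, hψy⟩ := exists_mem_eq_on_of_total x 𝒴 h𝒴 y
  have hmem : (fun j => y (x j)) ∈ L.range := ⟨⟨ψ, hψ⟩, funext hψy⟩
  have hTR : T (fun j => y (x j)) = R ⟨_, hmem⟩ := LinearMap.congr_fun hT ⟨_, hmem⟩
  have hLR := congrArg Subtype.val (LinearMap.congr_fun hR ⟨_, hmem⟩)
  change (T (fun j => y (x j)) : X →L[ℝ] ℝ) (x i) = y (x i)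
  rw [hTR]
  exact congrFun hLR i

/-- Rescaling a nonzero vector `w` to the norm of `y` at most doubles its distance to `y`. -/
theorem norm_rescale_sub_le {V : Type*} [NormedAddCommGroup V] [NormedSpace ℝ V] {w : V}
    (hw : w ≠ 0) (y : V) : ‖(‖y‖ / ‖w‖) • w - y‖ ≤ 2 * ‖w - y‖ := by
  have hw' : ‖w‖ ≠ 0 := norm_ne_zero_iff.mpr hw
  have h : ‖(‖y‖ / ‖w‖) • w - w‖ ≤ ‖w - y‖ := by
    rw [show (‖y‖ / ‖w‖) • w - w = (‖y‖ / ‖w‖ - 1) • w by rw [sub_smul, one_smul],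
      norm_smul, Real.norm_eq_abs, ← abs_norm w, ← abs_mul, abs_norm,
      sub_mul, div_mul_cancel₀ _ hw', one_mul, norm_sub_rev]
    exact abs_norm_sub_norm_le y w
  linarith [norm_sub_le_norm_sub_add_norm_sub ((‖y‖ / ‖w‖) • w) w y]

/-- Lemma 2: Let `E = span{x₀, …, x_m}` be a finite dimensional subspace of a Banach space
`X` and let `𝒴` be a total linear subspace of `X*`.  For each `ε > 0` there exists `η > 0`
such that whenever `y* ∈ X*` satisfies `|y*(xᵢ)| < η` for each `0 ≤ i ≤ m`, there exists
`x* ∈ E^⊥` whose norm is `0` or `‖y*‖` with `‖x* - y*‖ < ε`; moreover if `y* ∈ 𝒴` then `x*`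
can be taken in `𝒴`. -/
theorem perturbation_lemma (X : Type*) [NormedAddCommGroup X] [NormedSpace ℝ X]
    [CompleteSpace X] (m : ℕ) (x : Fin (m + 1) → X)
    (𝒴 : Submodule ℝ (X →L[ℝ] ℝ))
    (h𝒴total : ∀ v : X, (∀ ψ ∈ 𝒴, ψ v = 0) → v = 0)
    (ε : ℝ) (hε : 0 < ε) :
    ∃ η : ℝ, 0 < η ∧
      ∀ y : X →L[ℝ] ℝ, (∀ i, |y (x i)| < η) →
        ∃ z : X →L[ℝ] ℝ,
          (∀ v ∈ Submodule.span ℝ (Set.range x), z v = 0) ∧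
          (‖z‖ = 0 ∨ ‖z‖ = ‖y‖) ∧
          ‖z - y‖ < ε ∧
          (y ∈ 𝒴 → z ∈ 𝒴) := by
  obtain ⟨S, hS𝒴, hS⟩ := exists_continuousLinearMap_interpolating x 𝒴 h𝒴total
  have hK : 0 < 2 * (‖S‖ + 1) := by positivity
  refine ⟨ε / (2 * (‖S‖ + 1)), div_pos hε hK, fun y hy => ?_⟩
  set c : Fin (m + 1) → ℝ := fun i => y (x i)
  have hc : ‖c‖ < ε / (2 * (‖S‖ + 1)) := (pi_norm_lt_iff (div_pos hε hK)).mpr hy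
  have hbound : 2 * ‖S c‖ < ε := by
    rw [lt_div_iff₀ hK] at hc
    linarith [S.le_opNorm c, norm_nonneg c]
  set w : X →L[ℝ] ℝ := y - S c with hw
  have hwE : ∀ v ∈ Submodule.span ℝ (Set.range x), w v = 0 := by
    intro v hv
    refine (Submodule.span_le (p := LinearMap.ker w.toLinearMap)).mpr ?_ hv
    rintro _ ⟨i, rfl⟩
    exact sub_eq_zero.mpr (hS y i).symm
  have hw𝒴 : y ∈ 𝒴 → w ∈ 𝒴 := fun h => 𝒴.sub_mem h (hS𝒴 c)
  have hwy : ‖w - y‖ = ‖S c‖ := by rw [hw, sub_sub_cancel_left, norm_neg]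
  by_cases hw0 : w = 0
  · exact ⟨w, hwE, .inl (by rw [hw0, norm_zero]), by linarith [norm_nonneg (S c)], hw𝒴⟩
  · refine ⟨(‖y‖ / ‖w‖) • w, fun v hv => ?_, .inr ?_, ?_, fun h => 𝒴.smul_mem _ (hw𝒴 h)⟩
    · rw [smul_apply, hwE v hv, smul_zero]
    · rw [norm_smul, norm_div, norm_norm, norm_norm,
        div_mul_cancel₀ _ (norm_ne_zero_iff.mpr hw0)]
    · linarith [norm_rescale_sub_le hw0 y]
end

section
/- Let f_0, …, f_n ∈ L1, let α_0, …, α_n be real scalars, and set S = { g ∈ B(L∞) : ∫ f_i g dμ = α_i for each 0 ≤ i ≤ n }. Then the set of extreme points of S equals S ∩ ext B(L∞); that is, it consists exactly of those g ∈ S with |g(t)| = 1 for almost every t. Moreover, if S is nonempty then S has an extreme point. -/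
open MeasureTheory Filter Topology

/-- Lebesgue measure on `[0,1]`. -/
noncomputable def mu : Measure ℝ := volume.restrict (Set.Icc 0 1)

/-- Every functional of norm at most one on `L¹` of a finite measure is given by integration against
a function in the unit ball of `L∞`. -/
theorem exists_lpPairing_eq {X : Type*} [MeasurableSpace X] {μ : Measure X} [IsFiniteMeasure μ]
    (φ : StrongDual ℝ (Lp ℝ 1 μ)) (hφ : ‖φ‖ ≤ 1) :
    ∃ g : Lp ℝ ⊤ μ, ‖g‖ ≤ 1 ∧ (ContinuousLinearMap.mul ℝ ℝ).lpPairing μ ⊤ 1 g = φ := by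
  let one : Lp ℝ 2 μ := indicatorConstLp 2 MeasurableSet.univ (measure_ne_top μ _) 1
  let ι : Lp ℝ 2 μ →L[ℝ] Lp ℝ 1 μ := (ContinuousLinearMap.mul ℝ ℝ).holderL μ 2 2 1 one
  have hι (s : Set X) (hs : MeasurableSet s) :
      ι (indicatorConstLp 2 hs (measure_ne_top μ s) 1) =
        indicatorConstLp 1 hs (measure_ne_top μ s) 1 := by
    refine Lp.ext ?_
    filter_upwards [(ContinuousLinearMap.mul ℝ ℝ).coeFn_holder (r := 1) one
        (indicatorConstLp 2 hs (measure_ne_top μ s) 1),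
      indicatorConstLp_coeFn (p := 2) (c := (1 : ℝ)) (hs := MeasurableSet.univ)
        (hμs := measure_ne_top μ _),
      indicatorConstLp_coeFn (p := 2) (c := (1 : ℝ)) (hs := hs) (hμs := measure_ne_top μ s),
      indicatorConstLp_coeFn (p := 1) (c := (1 : ℝ)) (hs := hs) (hμs := measure_ne_top μ s)]
      with x h1 h2 h3 h4
    simp only [ι, ContinuousLinearMap.holderL_apply_apply]
    rw [h1, h4, h3, h2]
    simp
  let h : Lp ℝ 2 μ := (InnerProductSpace.toDual ℝ (Lp ℝ 2 μ)).symm (φ.comp ι)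
  have hint : Integrable h μ := (Lp.memLp h).integrable (by norm_num)
  have hset (s : Set X) (hs : MeasurableSet s) :
      ∫ x in s, h x ∂μ = φ (indicatorConstLp 1 hs (measure_ne_top μ s) 1) := by
    rw [← L2.inner_indicatorConstLp_one (𝕜 := ℝ) hs (measure_ne_top μ s) h, real_inner_comm,
      InnerProductSpace.toDual_symm_apply, ContinuousLinearMap.comp_apply, hι]
  have hbound (s : Set X) (hs : MeasurableSet s) : |∫ x in s, h x ∂μ| ≤ μ.real s := by
    rw [hset s hs]
    refine (φ.le_of_opNorm_le hφ _).trans ?_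
    rw [norm_indicatorConstLp one_ne_zero ENNReal.one_ne_top]
    simp
  have hle : ∀ᵐ x ∂μ, h x ≤ 1 :=
    ae_le_of_forall_setIntegral_le hint (integrable_const 1) fun s hs _ => by
      simpa using (abs_le.1 (hbound s hs)).2
  have hge : ∀ᵐ x ∂μ, -1 ≤ h x :=
    ae_le_of_forall_setIntegral_le (integrable_const (-1)) hint fun s hs _ => by
      simpa using (abs_le.1 (hbound s hs)).1
  have hb : ∀ᵐ x ∂μ, ‖h x‖ ≤ 1 := by
    filter_upwards [hle, hge] with x h1 h2 using abs_le.2 ⟨h2, h1⟩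
  have hmem : MemLp h ⊤ μ := memLp_top_of_bound (Lp.aestronglyMeasurable h) 1 hb
  refine ⟨hmem.toLp, ?_, ?_⟩
  · have := Lp.norm_le_of_ae_bound (f := hmem.toLp) zero_le_one (by
      filter_upwards [hmem.coeFn_toLp, hb] with x h1 h2
      rwa [h1])
    simpa using this
  · ext f
    induction f using Lp.induction (hp_ne_top := ENNReal.one_ne_top) with
    | indicatorConst c hs hμs =>
      rename_i s
      rw [Lp.simpleFunc.coe_indicatorConst]
      have hc : indicatorConstLp 1 hs hμs.ne c =
          c • (indicatorConstLp 1 hs hμs.ne (1 : ℝ) : Lp ℝ 1 μ) := by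
        rw [indicatorConstLp, indicatorConstLp, ← MemLp.toLp_const_smul]
        exact MemLp.toLp_congr _ _ (.of_forall fun x => by by_cases hx : x ∈ s <;> simp [hx])
      rw [hc, map_smul, map_smul, ← hset s hs, ContinuousLinearMap.lpPairing_eq_integral,
        ← integral_indicator hs]
      congr 1
      refine integral_congr_ae ?_
      filter_upwards [hmem.coeFn_toLp, indicatorConstLp_coeFn (p := 1) (c := (1 : ℝ)) (hs := hs)
        (hμs := measure_ne_top μ s)] with x h1 h2
      rw [h1, h2]
      by_cases hx : x ∈ s <;> simp [hx]
    | add hf hg hd h1 h2 => rw [map_add, map_add, h1, h2]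
    | isClosed => exact isClosed_eq (by fun_prop) (by fun_prop)

theorem Lp_top_norm_le_one_iff {X : Type*} [MeasurableSpace X] {μ : Measure X} [IsFiniteMeasure μ]
    (g : Lp ℝ ⊤ μ) : ‖g‖ ≤ 1 ↔ ∀ᵐ t ∂μ, |g t| ≤ 1 := by
  refine ⟨fun h => ?_, fun h => by
    simpa using Lp.norm_le_of_ae_bound (f := g) zero_le_one h⟩
  filter_upwards [ae_le_lpNorm_exponent_top (Lp.memLp g)] with t ht
  refine le_trans ht ?_
  rwa [← toReal_eLpNorm (Lp.aestronglyMeasurable g), ← Lp.norm_def]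

/-- The functions `g` in the unit ball of `L∞` whose pairings with the `f i` are the `α i`. -/
def slice {X ι : Type*} [MeasurableSpace X] (μ : Measure X) [IsFiniteMeasure μ]
    (f : ι → Lp ℝ 1 μ) (α : ι → ℝ) : Set (Lp ℝ ⊤ μ) :=
  {g | ‖g‖ ≤ 1 ∧ ∀ i, (ContinuousLinearMap.mul ℝ ℝ).lpPairing μ ⊤ 1 g (f i) = α i}

theorem lpPairing_injective {X : Type*} [MeasurableSpace X] (μ : Measure X) [IsFiniteMeasure μ] :
    Function.Injective ((ContinuousLinearMap.mul ℝ ℝ).lpPairing μ ⊤ 1) := by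
  intro g₁ g₂ h
  have hint (g : Lp ℝ ⊤ μ) : Integrable g μ := (Lp.memLp g).integrable le_top
  refine Lp.ext ((hint g₁).ae_eq_of_forall_setIntegral_eq _ _ (hint g₂) fun s hs hμs => ?_)
  have key (g : Lp ℝ ⊤ μ) : (ContinuousLinearMap.mul ℝ ℝ).lpPairing μ ⊤ 1 g
      (indicatorConstLp 1 hs hμs.ne 1) = ∫ x in s, g x ∂μ := by
    rw [ContinuousLinearMap.lpPairing_eq_integral, ← integral_indicator hs]
    refine integral_congr_ae ?_
    filter_upwards [indicatorConstLp_coeFn (p := 1) (c := (1 : ℝ)) (hs := hs) (hμs := hμs.ne)]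
      with x hx
    rw [hx]
    by_cases hx : x ∈ s <;> simp [hx]
  rw [← key, ← key, h]

theorem extremePoints_slice_nonempty {X ι : Type*} [MeasurableSpace X] {μ : Measure X}
    [IsFiniteMeasure μ] (f : ι → Lp ℝ 1 μ) (α : ι → ℝ) (h : (slice μ f α).Nonempty) :
    (Set.extremePoints ℝ (slice μ f α)).Nonempty := by
  let T := (ContinuousLinearMap.mul ℝ ℝ).lpPairing μ ⊤ 1
  let K : Set (WeakDual ℝ (Lp ℝ 1 μ)) :=
    WeakDual.toStrongDual ⁻¹' Metric.closedBall 0 1 ∩ ⋂ i, {φ | φ (f i) = α i}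
  have hK : IsCompact K := (WeakDual.isCompact_closedBall 0 1).inter_right
    (isClosed_iInter fun i => isClosed_eq (WeakDual.eval_continuous _) continuous_const)
  have hTK (g : Lp ℝ ⊤ μ) (hg : g ∈ slice μ f α) : StrongDual.toWeakDual (T g) ∈ K := by
    refine ⟨?_, Set.mem_iInter.2 hg.2⟩
    simp only [Set.mem_preimage, mem_closedBall_zero_iff]
    refine ContinuousLinearMap.opNorm_le_bound _ zero_le_one fun x => ?_
    change ‖T g x‖ ≤ _
    rw [ContinuousLinearMap.lpPairing_eq_integral, L1.norm_eq_integral_norm, one_mul]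
    refine norm_integral_le_of_norm_le (L1.integrable_coeFn x).norm ?_
    filter_upwards [(Lp_top_norm_le_one_iff g).1 hg.1] with t ht
    simpa using mul_le_mul_of_nonneg_right ht (abs_nonneg (x t))
  obtain ⟨g₀, hg₀⟩ := h
  have : LocallyConvexSpace ℝ (WeakDual ℝ (Lp ℝ 1 μ)) :=
    inferInstanceAs (LocallyConvexSpace ℝ (WeakBilin (topDualPairing ℝ (Lp ℝ 1 μ))))
  obtain ⟨φ, hφ⟩ := hK.extremePoints_nonempty ⟨_, hTK g₀ hg₀⟩
  obtain ⟨⟨hφ1, hφ2⟩, hφe⟩ := mem_extremePoints_iff_left.1 hφ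
  obtain ⟨g, hg, hgφ⟩ := exists_lpPairing_eq (WeakDual.toStrongDual φ)
    (mem_closedBall_zero_iff.1 hφ1)
  refine ⟨g, mem_extremePoints_iff_left.2 ⟨⟨hg, fun i => ?_⟩, fun x hx y hy hxy => ?_⟩⟩
  · rw [hgφ]
    exact Set.mem_iInter.1 hφ2 i
  · refine lpPairing_injective μ ?_
    rw [hgφ]
    refine hφe _ (hTK x hx) _ (hTK y hy) ?_
    obtain ⟨a, b, ha, hb, hab, rfl⟩ := hxy
    refine ⟨a, b, ha, hb, hab, ?_⟩
    rw [map_add, map_smul, map_smul] at hgφ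
    exact hgφ

theorem mem_extremePoints_slice_of_abs_eq_one {X ι : Type*} [MeasurableSpace X] {μ : Measure X}
    [IsFiniteMeasure μ] {f : ι → Lp ℝ 1 μ} {α : ι → ℝ} {g : Lp ℝ ⊤ μ} (hg : g ∈ slice μ f α)
    (h : ∀ᵐ t ∂μ, |g t| = 1) : g ∈ Set.extremePoints ℝ (slice μ f α) := by
  refine mem_extremePoints_iff_left.2 ⟨hg, fun x hx y hy hxy => Lp.ext ?_⟩
  obtain ⟨a, b, ha, hb, hab, rfl⟩ := hxy
  filter_upwards [h, (Lp_top_norm_le_one_iff x).1 hx.1, (Lp_top_norm_le_one_iff y).1 hy.1,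
    Lp.coeFn_add (a • x) (b • y), Lp.coeFn_smul a x, Lp.coeFn_smul b y] with t ht hxt hyt h1 h2 h3
  rw [h1, Pi.add_apply, h2, h3, Pi.smul_apply, Pi.smul_apply, smul_eq_mul, smul_eq_mul] at ht ⊢
  obtain rfl : a = 1 - b := by linarith
  rw [abs_le] at hxt hyt
  rcases (abs_eq zero_le_one).1 ht with h | h
  · nlinarith
  · nlinarith

theorem Polynomial.exists_ne_zero_map_eq_zero {K V : Type*} [Field K] [AddCommGroup V] [Module K V]
    [FiniteDimensional K V] (L : Polynomial K →ₗ[K] V) : ∃ p ≠ 0, L p = 0 := by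
  by_contra! h
  have hL : Function.Injective L := (injective_iff_map_eq_zero L).2 fun p hp => by
    by_contra h0
    exact h p h0 hp
  exact Polynomial.not_finite (Module.Finite.of_injective L hL)

instance : IsFiniteMeasure mu := inferInstanceAs (IsFiniteMeasure (volume.restrict (Set.Icc 0 1)))

instance : NullSingletonClass mu :=
  inferInstanceAs (NullSingletonClass (volume.restrict (Set.Icc 0 1)))

theorem exists_ae_abs_eval_le (p : Polynomial ℝ) : ∃ M > 0, ∀ᵐ t ∂mu, |p.eval t| ≤ M := by
  obtain ⟨M, hM⟩ := isCompact_Icc.exists_bound_of_continuousOn (s := Set.Icc (0 : ℝ) 1)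
    p.continuous.continuousOn
  refine ⟨max M 1, by positivity, ?_⟩
  filter_upwards [ae_restrict_mem measurableSet_Icc] with t ht
  exact (hM t ht).trans (le_max_left _ _)

theorem abs_eq_one_of_mem_extremePoints_slice {ι : Type*} [Finite ι] {f : ι → Lp ℝ 1 mu}
    {α : ι → ℝ} {g : Lp ℝ ⊤ mu} (hg : g ∈ Set.extremePoints ℝ (slice mu f α)) :
    ∀ᵐ t ∂mu, |g t| = 1 := by
  obtain ⟨hgS, hge⟩ := mem_extremePoints_iff_left.1 hg
  have hg1 := (Lp_top_norm_le_one_iff g).1 hgS.1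
  have hmem (p : Polynomial ℝ) : MemLp (fun t => (1 - |g t|) * p.eval t) ⊤ mu := by
    obtain ⟨M, hM0, hM⟩ := exists_ae_abs_eval_le p
    refine memLp_top_of_bound ?_ M ?_
    · exact (aestronglyMeasurable_const.sub (Lp.aestronglyMeasurable g).norm).mul
        p.continuous.aestronglyMeasurable
    · filter_upwards [hg1, hM] with t h1 h2
      rw [Real.norm_eq_abs, abs_mul, abs_of_nonneg (sub_nonneg.2 h1)]
      nlinarith [abs_nonneg (g t), abs_nonneg (p.eval t)]
  let W : Polynomial ℝ →ₗ[ℝ] Lp ℝ ⊤ mu :=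
    { toFun := fun p => (hmem p).toLp
      map_add' := fun p q => by
        rw [← MemLp.toLp_add]
        exact MemLp.toLp_congr _ _ (.of_forall fun t => by simp [mul_add])
      map_smul' := fun c p => by
        rw [RingHom.id_apply, ← MemLp.toLp_const_smul]
        exact MemLp.toLp_congr _ _ (.of_forall fun t => by simp [mul_left_comm]) }
  let T := (ContinuousLinearMap.mul ℝ ℝ).lpPairing mu ⊤ 1
  let L : Polynomial ℝ →ₗ[ℝ] ι → ℝ :=
    LinearMap.pi fun i => (T.flip (f i)).toLinearMap ∘ₗ W
  obtain ⟨p, hp0, hLp⟩ := Polynomial.exists_ne_zero_map_eq_zero L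
  have hTp (i : ι) : T (W p) (f i) = 0 := congrFun hLp i
  obtain ⟨M, hM0, hM⟩ := exists_ae_abs_eval_le p
  have hmemS (c : ℝ) (hc : |c| = M⁻¹) : g + c • W p ∈ slice mu f α := by
    refine ⟨(Lp_top_norm_le_one_iff _).2 ?_, fun i => ?_⟩
    · filter_upwards [hg1, hM, Lp.coeFn_add g (c • W p), Lp.coeFn_smul c (W p),
        (hmem p).coeFn_toLp] with t h1 h2 h3 h4 h5
      have h5' : W p t = (1 - |g t|) * p.eval t := h5
      rw [h3, Pi.add_apply, h4, Pi.smul_apply, h5', smul_eq_mul]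
      have h6 : |c * ((1 - |g t|) * p.eval t)| ≤ 1 - |g t| := by
        rw [abs_mul, abs_mul, hc, abs_of_nonneg (sub_nonneg.2 h1), inv_mul_le_iff₀ hM0, mul_comm]
        exact mul_le_mul_of_nonneg_right h2 (sub_nonneg.2 h1)
      linarith [abs_add_le (g t) (c * ((1 - |g t|) * p.eval t))]
    · change T (g + c • W p) (f i) = α i
      rw [map_add, map_smul, add_apply, smul_apply, hTp, smul_zero, add_zero]
      exact hgS.2 i
  have hM' : |M⁻¹| = M⁻¹ := abs_of_pos (inv_pos.2 hM0)
  have hW : W p = 0 := by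
    have := hge _ (hmemS M⁻¹ hM') _ (hmemS (-M⁻¹) (by rw [abs_neg, hM']))
      ⟨1 / 2, 1 / 2, by norm_num, by norm_num, by norm_num, by module⟩
    simpa [hM0.ne'] using this
  have hroot : ∀ᵐ t ∂mu, p.eval t ≠ 0 := by
    refine measure_mono_null (fun t ht => ?_) (p.roots.toFinset.finite_toSet.measure_zero mu)
    simpa [hp0] using ht
  filter_upwards [hroot, (hmem p).coeFn_toLp, Lp.coeFn_zero ℝ ⊤ mu] with t h1 h2 h3
  have h4 : W p t = (1 - |g t|) * p.eval t := h2
  rw [hW, h3, Pi.zero_apply, eq_comm, mul_eq_zero] at h4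
  linarith [h4.resolve_right h1]

/-- Lemma 3: for `f₀, …, f_n ∈ L₁` and scalars `α₀, …, α_n`, let
`S = { g ∈ B(L∞) : ∫ fᵢ g dμ = αᵢ for each i }`.  Then the extreme points of `S` are exactly
the elements of `S` that are extreme points of the unit ball of `L∞`, i.e. those `g ∈ S`
with `|g| = 1` almost everywhere; moreover if `S` is nonempty, it has an extreme point. -/
theorem extreme_points_of_slice (n : ℕ) (f : Fin (n + 1) → Lp ℝ 1 mu)
    (α : Fin (n + 1) → ℝ) (S : Set (Lp ℝ ⊤ mu))
    (hS : S = {g : Lp ℝ ⊤ mu | ‖g‖ ≤ 1 ∧ ∀ i, ∫ t, f i t * g t ∂mu = α i}) :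
    Set.extremePoints ℝ S = {g ∈ S | ∀ᵐ t ∂mu, |g t| = 1} ∧
    (S.Nonempty → (Set.extremePoints ℝ S).Nonempty) := by
  obtain rfl : S = slice mu f α := by
    simp only [hS, slice, ContinuousLinearMap.lpPairing_eq_integral, ContinuousLinearMap.mul_apply',
      mul_comm]
  exact ⟨Set.Subset.antisymm
    (fun g hg => ⟨extremePoints_subset hg, abs_eq_one_of_mem_extremePoints_slice hg⟩)
    fun g hg => mem_extremePoints_slice_of_abs_eq_one hg.1 hg.2,
    extremePoints_slice_nonempty f α⟩
end

section
/- Let X be a Banach space and let T : L1 → X be a bounded linear operator that is not completely continuous. Then there exist a linear isometric embedding A : L1 → L1 and a bounded linear operator B : X → ℓ∞ such that B ∘ T ∘ A = T0, i.e. (B(T(A f)))_n = ∫ r_n f dμ for every f ∈ L1 and every n ≥ 0. -/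
open MeasureTheory Filter Topology

/-- The `n`-th Rademacher function `r_n(t) = (-1)^⌊2^n t⌋`. -/
noncomputable def rademacher (n : ℕ) (t : ℝ) : ℝ := (-1 : ℝ) ^ ⌊(2 : ℝ) ^ n * t⌋

/-- A bounded linear operator between Banach spaces is completely continuous if it maps
weakly convergent sequences to norm convergent sequences. -/
def CompletelyContinuous {X Z : Type*} [NormedAddCommGroup X] [NormedSpace ℝ X]
    [NormedAddCommGroup Z] [NormedSpace ℝ Z] (T : X →L[ℝ] Z) : Prop :=
  ∀ (x : ℕ → X) (x₀ : X),
    (∀ φ : X →L[ℝ] ℝ, Tendsto (fun n => φ (x n)) atTop (𝓝 (φ x₀))) →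
    Tendsto (fun n => T (x n)) atTop (𝓝 (T x₀))

theorem integrable_mul_of_bounded {Ω : Type*} [MeasurableSpace Ω] {μ : Measure Ω} {g f : Ω → ℝ}
    {R : ℝ} (hg : Measurable g) (hR : ∀ t, |g t| ≤ R) (hf : Integrable f μ) :
    Integrable (fun t => g t * f t) μ :=
  hf.bdd_mul hg.aestronglyMeasurable (Eventually.of_forall hR)

theorem exists_dual_of_bounded {Ω : Type*} [MeasurableSpace Ω] {μ : Measure Ω} {g : Ω → ℝ}
    {R : ℝ} (hg : Measurable g) (h0 : 0 ≤ R) (hR : ∀ t, |g t| ≤ R) :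
    ∃ l : Lp ℝ 1 μ →L[ℝ] ℝ, ‖l‖ ≤ R ∧ ∀ f : Lp ℝ 1 μ, l f = ∫ t, g t * f t ∂μ := by
  have hgi (f : Lp ℝ 1 μ) : Integrable (fun t => g t * f t) μ :=
    integrable_mul_of_bounded hg hR (L1.integrable_coeFn f)
  let l₀ : Lp ℝ 1 μ →ₗ[ℝ] ℝ :=
    { toFun := fun f => ∫ t, g t * f t ∂μ
      map_add' := fun f₁ f₂ => by
        rw [← integral_add (hgi f₁) (hgi f₂)]
        refine integral_congr_ae ?_
        filter_upwards [Lp.coeFn_add f₁ f₂] with t ht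
        rw [ht, Pi.add_apply, mul_add]
      map_smul' := fun c f => by
        rw [RingHom.id_apply, smul_eq_mul, ← integral_const_mul]
        refine integral_congr_ae ?_
        filter_upwards [Lp.coeFn_smul c f] with t ht
        rw [ht, Pi.smul_apply, smul_eq_mul, mul_left_comm] }
  have hl₀ (f : Lp ℝ 1 μ) : ‖l₀ f‖ ≤ R * ‖f‖ := by
    rw [L1.norm_eq_integral_norm, ← integral_const_mul]
    refine norm_integral_le_of_norm_le ((L1.integrable_coeFn f).norm.const_mul R)
      (Eventually.of_forall fun t => ?_)
    rw [norm_mul]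
    exact mul_le_mul_of_nonneg_right (hR t) (norm_nonneg _)
  exact ⟨l₀.mkContinuous R hl₀, l₀.mkContinuous_norm_le h0 hl₀, fun f => rfl⟩

theorem exists_density {Ω : Type*} [MeasurableSpace Ω] {μ : Measure Ω} [IsFiniteMeasure μ]
    (l : Lp ℝ 1 μ →L[ℝ] ℝ) :
    ∃ b : Ω → ℝ, Measurable b ∧ (∀ t, |b t| ≤ ‖l‖) ∧
      ∀ f : Lp ℝ 1 μ, l f = ∫ t, b t * f t ∂μ := by
  set J : Lp ℝ 2 μ →L[ℝ] Lp ℝ 1 μ := (ContinuousLinearMap.mul ℝ ℝ).holderL μ 2 2 1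
    (indicatorConstLp 2 MeasurableSet.univ (measure_ne_top μ _) 1) with hJ
  have hJc (f : Lp ℝ 2 μ) : J f =ᵐ[μ] f := by
    have h1 := (ContinuousLinearMap.mul ℝ ℝ).coeFn_holder (r := 1)
      (indicatorConstLp 2 MeasurableSet.univ (measure_ne_top μ _) (1 : ℝ)) f
    have h2 := indicatorConstLp_coeFn (μ := μ) (p := 2) (hs := MeasurableSet.univ)
      (hμs := measure_ne_top μ _) (c := (1 : ℝ))
    filter_upwards [h1, h2] with t ht ht2
    have : (J f : Ω → ℝ) t = _ := ht
    rw [this, ht2]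
    simp
  set b₀ : Lp ℝ 2 μ := (InnerProductSpace.toDual ℝ (Lp ℝ 2 μ)).symm (l.comp J) with hb₀
  have hb₀i : Integrable b₀ μ := (Lp.memLp b₀).integrable (by norm_num)
  have hind {s : Set Ω} (hs : MeasurableSet s) :
      l (indicatorConstLp 1 hs (measure_ne_top μ s) 1) = ∫ t in s, b₀ t ∂μ := by
    have e1 : J (indicatorConstLp 2 hs (measure_ne_top μ s) 1) =
        indicatorConstLp 1 hs (measure_ne_top μ s) (1 : ℝ) := by
      refine Lp.ext ((hJc _).trans ?_)
      exact indicatorConstLp_coeFn.trans indicatorConstLp_coeFn.symm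
    have e2 : inner ℝ b₀ (indicatorConstLp 2 hs (measure_ne_top μ s) 1) =
        l.comp J (indicatorConstLp 2 hs (measure_ne_top μ s) 1) :=
      InnerProductSpace.toDual_symm_apply
    rw [← e1, ← ContinuousLinearMap.comp_apply, ← e2, real_inner_comm,
      L2.inner_indicatorConstLp_one]
  have hindn {s : Set Ω} (hs : MeasurableSet s) : |∫ t in s, b₀ t ∂μ| ≤ ‖l‖ * μ.real s := by
    rw [← hind hs]
    refine (l.le_opNorm _).trans (mul_le_mul_of_nonneg_left ?_ (norm_nonneg _))
    rw [norm_indicatorConstLp (by norm_num) (by norm_num)]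
    simp
  have hle : ∀ᵐ t ∂μ, b₀ t ≤ ‖l‖ := by
    refine ae_le_of_forall_setIntegral_le hb₀i (integrable_const _) fun s hs _ => ?_
    rw [setIntegral_const, smul_eq_mul, mul_comm]
    exact (le_abs_self _).trans (hindn hs)
  have hge : ∀ᵐ t ∂μ, -‖l‖ ≤ b₀ t := by
    refine ae_le_of_forall_setIntegral_le (integrable_const _) hb₀i fun s hs _ => ?_
    rw [setIntegral_const, smul_eq_mul, mul_neg, mul_comm]
    exact (abs_le.1 (hindn hs)).1
  obtain ⟨b₁, hb₁m, hb₁⟩ := hb₀i.aestronglyMeasurable.aemeasurable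
  set b : Ω → ℝ := fun t => max (-‖l‖) (min ‖l‖ (b₁ t)) with hb
  have hbm : Measurable b := measurable_const.max (measurable_const.min hb₁m)
  have hbb : ∀ t, |b t| ≤ ‖l‖ := fun t => abs_le.2
    ⟨le_max_left _ _, max_le (by linarith [norm_nonneg l]) (min_le_left _ _)⟩
  have hbe : b =ᵐ[μ] b₀ := by
    filter_upwards [hb₁, hle, hge] with t h1 h2 h3
    simp only [hb, ← h1, min_eq_right h2, max_eq_right h3]
  obtain ⟨l', -, hl'⟩ := exists_dual_of_bounded (μ := μ) hbm (norm_nonneg l) hbb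
  refine ⟨b, hbm, hbb, fun f => ?_⟩
  rw [← hl']
  refine Lp.induction (by norm_num) (motive := fun f : Lp ℝ 1 μ => l f = l' f) ?_ ?_ ?_ f
  · intro c s hs hμs
    have : (Lp.simpleFunc.indicatorConst 1 hs hμs.ne c : Lp ℝ 1 μ) =
        c • indicatorConstLp 1 hs (measure_ne_top μ s) (1 : ℝ) := by
      rw [Lp.simpleFunc.coe_indicatorConst]
      refine Lp.ext ?_
      filter_upwards [indicatorConstLp_coeFn (μ := μ) (p := 1) (hs := hs) (hμs := hμs.ne) (c := c),
        Lp.coeFn_smul c (indicatorConstLp 1 hs (measure_ne_top μ s) (1 : ℝ)),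
        indicatorConstLp_coeFn (μ := μ) (p := 1) (hs := hs)
          (hμs := measure_ne_top μ s) (c := (1 : ℝ))] with t h1 h2 h3
      rw [h1, h2, Pi.smul_apply, h3]
      by_cases ht : t ∈ s <;> simp [ht]
    rw [this, map_smul, map_smul, hind hs, hl']
    congr 1
    rw [← integral_indicator hs]
    refine integral_congr_ae ?_
    filter_upwards [indicatorConstLp_coeFn (μ := μ) (p := 1) (hs := hs)
      (hμs := measure_ne_top μ s) (c := (1 : ℝ)), hbe] with t h1 h2
    rw [h1]
    by_cases ht : t ∈ s <;> simp [ht, h2]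
  · intro f g hf hg _ h1 h2
    rw [map_add, map_add, h1, h2]
  · exact isClosed_eq l.continuous l'.continuous

theorem exists_weakStar_limit {X : Type*} [NormedAddCommGroup X] [NormedSpace ℝ X]
    (U : Ultrafilter ℕ) {y : ℕ → X →L[ℝ] ℝ} {R : ℝ} (hy : ∀ n, ‖y n‖ ≤ R) :
    ∃ y₀ : X →L[ℝ] ℝ, ‖y₀‖ ≤ R ∧ ∀ x, Tendsto (fun n => y n x) U (𝓝 (y₀ x)) := by
  obtain ⟨y₀, hy₀, hlim⟩ := (WeakDual.isCompact_closedBall (0 : X →L[ℝ] ℝ) R).ultrafilter_le_nhds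
    (U.map fun n => StrongDual.toWeakDual (y n)) (by
      rw [Ultrafilter.coe_map]
      refine tendsto_principal.2 (Eventually.of_forall fun n => ?_)
      simpa using hy n)
  refine ⟨WeakDual.toStrongDual y₀, by simpa using hy₀, fun x => ?_⟩
  exact ((WeakDual.eval_continuous x).tendsto y₀).comp hlim

theorem exists_weak_limit {Ω : Type*} [MeasurableSpace Ω] {μ : Measure Ω} [IsFiniteMeasure μ]
    (U : Ultrafilter ℕ) {g : ℕ → Ω → ℝ} {R : ℝ} (hg : ∀ n, Measurable (g n))
    (hR : ∀ n t, |g n t| ≤ R) (h0 : 0 ≤ R) :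
    ∃ g₀ : Ω → ℝ, Measurable g₀ ∧ (∀ t, |g₀ t| ≤ R) ∧ ∀ f : Ω → ℝ, Integrable f μ →
      Tendsto (fun n => ∫ t, g n t * f t ∂μ) U (𝓝 (∫ t, g₀ t * f t ∂μ)) := by
  choose l hl hlf using fun n => exists_dual_of_bounded (μ := μ) (hg n) h0 (hR n)
  obtain ⟨l₀, hl₀, hlim⟩ := exists_weakStar_limit U hl
  obtain ⟨g₀, hg₀, hb, hg₀f⟩ := exists_density l₀
  refine ⟨g₀, hg₀, fun t => (hb t).trans hl₀, fun f hf => ?_⟩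
  have h := hlim (hf.toL1 f)
  have e (u : Ω → ℝ) : ∫ t, u t * (hf.toL1 f) t ∂μ = ∫ t, u t * f t ∂μ := by
    refine integral_congr_ae ?_
    filter_upwards [hf.coeFn_toL1] with t ht
    rw [ht]
  simpa only [hlf, hg₀f, e] using h

/-- If finitely many functionals tend to zero along `v`, then `v` can be modified by a null
sequence so that they vanish. -/
theorem exists_tendsto_zero_correction {V ι : Type*} [NormedAddCommGroup V] [NormedSpace ℝ V]
    [Fintype ι] (G : ι → V →L[ℝ] ℝ) {v : ℕ → V} {U : Filter ℕ}
    (h : ∀ i, Tendsto (fun n => G i (v n)) U (𝓝 0)) :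
    ∃ w : ℕ → V, (∀ n i, G i (w n) = G i (v n)) ∧ Tendsto w U (𝓝 0) := by
  let L : V →ₗ[ℝ] (ι → ℝ) := LinearMap.pi fun i => (G i : V →ₗ[ℝ] ℝ)
  obtain ⟨S, hS⟩ := L.rangeRestrict.exists_rightInverse_of_surjective L.range_rangeRestrict
  have hSc : Continuous S := S.continuous_of_finiteDimensional
  refine ⟨fun n => S (L.rangeRestrict (v n)), fun n i => ?_, ?_⟩
  · have := LinearMap.congr_fun hS (L.rangeRestrict (v n))
    have := congrArg (fun z : LinearMap.range L => (z : ι → ℝ) i) this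
    simpa [L] using this
  · have h1 : Tendsto (fun n => L.rangeRestrict (v n)) U (𝓝 0) := by
      rw [tendsto_subtype_rng, tendsto_pi_nhds]
      exact h
    simpa [Function.comp_def] using (hSc.tendsto 0).comp h1

instance : IsProbabilityMeasure mu := ⟨by simp [mu]⟩

instance inst_s4 : NullSingletonClass mu := by unfold mu; infer_instance

theorem ae_mem_Icc : ∀ᵐ t ∂mu, t ∈ Set.Icc (0 : ℝ) 1 := ae_restrict_mem measurableSet_Icc

theorem exists_bounded_orthogonal {ι : Type*} [Finite ι] {h : ι → ℝ → ℝ}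
    (hh : ∀ i, Integrable (h i) mu) {D : Set ℝ} (hD : MeasurableSet D) (hD0 : mu D ≠ 0)
    {ε : ℝ} (hε : 0 < ε) :
    ∃ ψ : ℝ → ℝ, Measurable ψ ∧ (∀ t, |ψ t| ≤ ε) ∧ (∀ t ∉ D, ψ t = 0) ∧
      (∀ i, ∫ t, ψ t * h i t ∂mu = 0) ∧ ¬ (ψ =ᵐ[mu] 0) := by
  classical
  have hbm (p : Polynomial ℝ) (i : ι) : Integrable (fun t => p.eval t * (D.indicator (h i) t)) mu := by
    obtain ⟨C, hC⟩ := isCompact_Icc.exists_bound_of_continuousOn (s := Set.Icc (0 : ℝ) 1)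
      p.continuous.continuousOn
    refine ((hh i).indicator hD).bdd_mul (c := C) p.continuous.aestronglyMeasurable ?_
    filter_upwards [ae_mem_Icc] with t ht using hC t ht
  let Φ : Polynomial ℝ →ₗ[ℝ] (ι → ℝ) := LinearMap.pi fun i =>
    { toFun := fun p => ∫ t, p.eval t * (D.indicator (h i) t) ∂mu
      map_add' := fun p q => by
        rw [← integral_add (hbm p i) (hbm q i)]
        simp [add_mul]
      map_smul' := fun c p => by
        rw [RingHom.id_apply, smul_eq_mul, ← integral_const_mul]
        simp [mul_assoc] }
  have hΦ : ¬ Function.Injective Φ := fun hinj =>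
    Polynomial.not_finite (R := ℝ) (Module.Finite.of_injective Φ hinj)
  obtain ⟨p, hp0, hpΦ⟩ : ∃ p ≠ 0, Φ p = 0 := by
    by_contra! hcon
    exact hΦ ((injective_iff_map_eq_zero Φ).2 fun p hp => by_contra fun h0 => hcon p h0 hp)
  obtain ⟨C, hC⟩ := isCompact_Icc.exists_bound_of_continuousOn (s := Set.Icc (0 : ℝ) 1)
      p.continuous.continuousOn
  set C' := |C| + 1
  have hC' : 0 < C' := by positivity
  refine ⟨fun t => ε / C' * (D ∩ Set.Icc 0 1).indicator p.eval t, ?_, fun t => ?_, ?_, fun i => ?_,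
    fun hz => ?_⟩
  · exact (p.continuous.measurable.indicator (hD.inter measurableSet_Icc)).const_mul _
  · rw [abs_mul, abs_of_pos (div_pos hε hC'), div_mul_eq_mul_div, div_le_iff₀ hC']
    refine mul_le_mul_of_nonneg_left ?_ hε.le
    by_cases ht : t ∈ D ∩ Set.Icc 0 1
    · rw [Set.indicator_of_mem ht]
      have := hC t ht.2
      rw [Real.norm_eq_abs] at this
      linarith [le_abs_self C]
    · rw [Set.indicator_of_notMem ht, abs_zero]
      exact hC'.le
  · intro t ht
    simp [ht]
  · have := congrFun hpΦ i
    simp only [Φ, LinearMap.pi_apply, LinearMap.coe_mk, AddHom.coe_mk, Pi.zero_apply] at this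
    refine Eq.trans ?_ ((integral_const_mul (ε / C') _).trans (by rw [this, mul_zero]))
    refine integral_congr_ae ?_
    filter_upwards [ae_mem_Icc] with t ht
    by_cases htD : t ∈ D
    · simp [htD, ht.1, ht.2, mul_assoc]
    · simp [htD]
  · have hroot : mu {t | p.eval t = 0} = 0 := by
      have : {t | p.eval t = 0} ⊆ (p.roots.toFinset : Set ℝ) := fun t ht => by
        simpa [hp0] using ht
      exact measure_mono_null this (Finset.measure_zero _ _)
    apply hD0
    have h1 : ∀ᵐ t ∂mu, t ∉ D := by
      have h2 : ∀ᵐ t ∂mu, p.eval t ≠ 0 := by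
        rw [ae_iff]; simpa using hroot
      filter_upwards [hz, h2, ae_mem_Icc] with t h4 h5 h6 htD
      have : t ∈ D ∩ Set.Icc 0 1 := ⟨htD, h6⟩
      simp only [Set.indicator_of_mem this, Pi.zero_apply] at h4
      exact (mul_ne_zero (div_pos hε hC').ne' h5) h4
    rw [ae_iff] at h1
    simpa using h1

/-- Lyapunov's convexity theorem, for densities. -/
theorem exists_sign_function {ι : Type*} [Finite ι] {h : ι → ℝ → ℝ}
    (hh : ∀ i, Integrable (h i) mu) {φ₀ : ℝ → ℝ} (hφ₀ : Measurable φ₀) (hb : ∀ t, |φ₀ t| ≤ 1) :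
    ∃ φ : ℝ → ℝ, Measurable φ ∧ (∀ t, φ t = 1 ∨ φ t = -1) ∧
      ∀ i, ∫ t, φ t * h i t ∂mu = ∫ t, φ₀ t * h i t ∂mu := by
  have htoL1 (u : ℝ → ℝ) (i : ι) :
      ∫ t, u t * ((hh i).toL1 (h i)) t ∂mu = ∫ t, u t * h i t ∂mu := by
    refine integral_congr_ae ?_
    filter_upwards [(hh i).coeFn_toL1] with t ht
    rw [ht]
  obtain ⟨l₀, hl₀, hl₀f⟩ := exists_dual_of_bounded (μ := mu) hφ₀ zero_le_one hb
  have : LocallyConvexSpace ℝ (WeakDual ℝ (Lp ℝ 1 mu)) :=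
    inferInstanceAs (LocallyConvexSpace ℝ (WeakBilin (topDualPairing ℝ (Lp ℝ 1 mu))))
  let K : Set (WeakDual ℝ (Lp ℝ 1 mu)) :=
    WeakDual.toStrongDual ⁻¹' Metric.closedBall (0 : Lp ℝ 1 mu →L[ℝ] ℝ) 1 ∩
      ⋂ i, {l | l ((hh i).toL1 (h i)) = ∫ t, φ₀ t * h i t ∂mu}
  have hK : IsCompact K := (WeakDual.isCompact_closedBall (0 : Lp ℝ 1 mu →L[ℝ] ℝ) 1).inter_right
    (isClosed_iInter fun i => isClosed_eq (WeakDual.eval_continuous _) continuous_const)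
  have hKne : K.Nonempty := by
    refine ⟨StrongDual.toWeakDual l₀, by simpa using hl₀, Set.mem_iInter.2 fun i => ?_⟩
    change l₀ _ = _
    rw [hl₀f, htoL1]
  obtain ⟨l, hlK, hlext⟩ := hK.extremePoints_nonempty hKne
  set l' : Lp ℝ 1 mu →L[ℝ] ℝ := WeakDual.toStrongDual l with hl'
  have hl'n : ‖l'‖ ≤ 1 := by simpa using hlK.1
  have hl'i (i : ι) : l' ((hh i).toL1 (h i)) = ∫ t, φ₀ t * h i t ∂mu := Set.mem_iInter.1 hlK.2 i
  obtain ⟨φ, hφm, hφb, hφ⟩ := exists_density l'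
  have key : ∀ᵐ t ∂mu, |φ t| = 1 := by
    have hk : ∀ k : ℕ, mu {t | |φ t| ≤ 1 - 1 / ((k : ℝ) + 1)} = 0 := by
      intro k
      by_contra hne
      have hkpos : (0 : ℝ) < 1 / ((k : ℝ) + 1) := by positivity
      obtain ⟨ψ, hψm, hψb, hψD, hψh, hψ0⟩ := exists_bounded_orthogonal hh
        (measurableSet_le hφm.abs measurable_const) hne hkpos
      have hsum {σ : ℝ} (hσ : |σ| ≤ 1) (t : ℝ) : |φ t + σ * ψ t| ≤ 1 := by
        by_cases ht : |φ t| ≤ 1 - 1 / ((k : ℝ) + 1)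
        · have h1 : |σ * ψ t| ≤ 1 * (1 / ((k : ℝ) + 1)) := by
            rw [abs_mul]
            exact mul_le_mul hσ (hψb t) (abs_nonneg _) zero_le_one
          linarith [abs_add_le (φ t) (σ * ψ t)]
        · rw [hψD t ht, mul_zero, add_zero]
          exact (hφb t).trans hl'n
      obtain ⟨m, -, hm⟩ := exists_dual_of_bounded (μ := mu) hψm hkpos.le hψb
      have hmem {σ : ℝ} (hσ : |σ| ≤ 1) : StrongDual.toWeakDual (l' + σ • m) ∈ K := by
        obtain ⟨q, hq, hqf⟩ := exists_dual_of_bounded (μ := mu)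
          (hφm.add (hψm.const_mul σ)) zero_le_one (hsum hσ)
        have hqe : l' + σ • m = q := by
          ext f
          have e1 := integrable_mul_of_bounded hφm hφb (L1.integrable_coeFn f)
          have e2 := integrable_mul_of_bounded hψm hψb (L1.integrable_coeFn f)
          rw [hqf]
          simp only [Pi.add_apply, add_mul, mul_assoc]
          rw [integral_add e1 (e2.const_mul σ), integral_const_mul]
          simp [hφ, hm]
        refine ⟨by simpa [hqe] using hq, Set.mem_iInter.2 fun i => ?_⟩
        change l' _ + σ • m _ = _
        rw [hl'i, hm, htoL1, hψh, smul_zero, add_zero]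
      have h1 := hlext (hmem (σ := 1) (by simp)) (hmem (σ := -1) (by simp))
        ⟨1 / 2, 1 / 2, by norm_num, by norm_num, by norm_num, by
          apply WeakDual.toStrongDual.injective
          ext f
          change (1 / 2 : ℝ) • (l' f + (1 : ℝ) • m f) + (1 / 2 : ℝ) • (l' f + (-1 : ℝ) • m f) = l' f
          simp only [smul_eq_mul]
          ring⟩
      have hm0 (f : Lp ℝ 1 mu) : m f = 0 := by
        have : l' f + (1 : ℝ) • m f = l' f :=
          congrArg (fun z : WeakDual ℝ (Lp ℝ 1 mu) => z f) h1
        simpa using this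
      have hψi : Integrable ψ mu :=
        Integrable.of_bound hψm.aestronglyMeasurable _ (Eventually.of_forall hψb)
      apply hψ0
      have h2 := hm0 (hψi.toL1 ψ)
      rw [hm] at h2
      have h3 : ∫ t, ψ t * ψ t ∂mu = 0 := by
        rw [← h2]
        refine integral_congr_ae ?_
        filter_upwards [hψi.coeFn_toL1] with t ht
        rw [ht]
      rw [integral_eq_zero_iff_of_nonneg (fun t => mul_self_nonneg _)
        (integrable_mul_of_bounded hψm hψb hψi)] at h3
      filter_upwards [h3] with t ht
      simpa using ht
    have hk' : ∀ᵐ t ∂mu, ∀ k : ℕ, ¬ |φ t| ≤ 1 - 1 / ((k : ℝ) + 1) := by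
      refine ae_all_iff.2 fun k => ?_
      rw [ae_iff]
      simpa using hk k
    filter_upwards [hk'] with t ht
    refine le_antisymm ((hφb t).trans hl'n) (le_of_forall_pos_le_add fun ε hε => ?_)
    obtain ⟨k, hk⟩ := exists_nat_one_div_lt hε
    linarith [not_le.1 (ht k)]
  refine ⟨fun t => if 0 ≤ φ t then 1 else -1,
    Measurable.ite (measurableSet_le measurable_const hφm) measurable_const measurable_const,
    fun t => by by_cases h0 : 0 ≤ φ t <;> simp [h0], fun i => ?_⟩
  rw [← hl'i, hφ, htoL1]
  refine integral_congr_ae ?_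
  filter_upwards [key] with t ht
  by_cases h0 : 0 ≤ φ t
  · rw [abs_of_nonneg h0] at ht
    simp [ht]
  · rw [abs_of_neg (not_le.1 h0)] at ht
    simp only [h0, if_false]
    rw [← ht]; ring

theorem isClosed_setOf_bounded_integral_mul_le {Ω : Type*} [MeasurableSpace Ω] {μ : Measure Ω}
    {w : Ω → ℝ} (hw : Integrable w μ) (ε : ℝ) :
    IsClosed {φ : Lp ℝ 1 μ | (∀ᵐ t ∂μ, |φ t| ≤ 1) ∧ |∫ t, φ t * w t ∂μ| ≤ ε} := by
  refine IsSeqClosed.isClosed fun u φ hu hlim => ?_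
  obtain ⟨ns, -, hns⟩ := (tendstoInMeasure_of_tendsto_Lp hlim).exists_seq_tendsto_ae
  have hall : ∀ᵐ t ∂μ, ∀ i, |u (ns i) t| ≤ 1 := ae_all_iff.2 fun i => (hu (ns i)).1
  have hb : ∀ᵐ t ∂μ, |φ t| ≤ 1 := by
    filter_upwards [hns, hall] with t h1 h2
    exact le_of_tendsto h1.abs (Eventually.of_forall h2)
  refine ⟨hb, ?_⟩
  have hI : Tendsto (fun i => ∫ t, u (ns i) t * w t ∂μ) atTop (𝓝 (∫ t, φ t * w t ∂μ)) := by
    refine tendsto_integral_of_dominated_convergence (fun t => |w t|)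
      (fun i => (Lp.aestronglyMeasurable _).mul hw.aestronglyMeasurable) hw.abs (fun i => ?_) ?_
    · filter_upwards [hall] with t ht
      rw [norm_mul]
      exact mul_le_of_le_one_left (abs_nonneg _) (ht i)
    · filter_upwards [hns] with t ht using ht.mul_const _
  exact le_of_tendsto hI.abs (Eventually.of_forall fun i => (hu (ns i)).2)

/-- Weakly null sequences in `L¹` are equi-integrable. -/
theorem equiintegrable_of_weakly_null {Ω : Type*} [MeasurableSpace Ω] {μ : Measure Ω}
    [IsFiniteMeasure μ] {z : ℕ → Lp ℝ 1 μ}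
    (hz : ∀ l : Lp ℝ 1 μ →L[ℝ] ℝ, Tendsto (fun n => l (z n)) atTop (𝓝 0)) {ε : ℝ} (hε : 0 < ε) :
    ∃ r > 0, ∃ N, ∀ n ≥ N, ∀ B, MeasurableSet B → μ.real B ≤ r → ∫ t in B, |z n t| ∂μ ≤ ε := by
  have hzi (n : ℕ) : Integrable (z n) μ := L1.integrable_coeFn _
  set K : Set (Lp ℝ 1 μ) := {φ | ∀ᵐ t ∂μ, |φ t| ≤ 1} with hK
  have hKc : IsClosed K := by
    have := isClosed_setOf_bounded_integral_mul_le (integrable_zero Ω ℝ μ) 0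
    simpa using this
  have : CompleteSpace K := hKc.completeSpace_coe
  have : Nonempty K := ⟨⟨0, by
    filter_upwards [Lp.coeFn_zero ℝ 1 μ] with t ht
    rw [ht]
    simp⟩⟩
  let C : ℕ → Set K := fun N => {φ | ∀ n ≥ N, |∫ t, (φ : Lp ℝ 1 μ) t * z n t ∂μ| ≤ ε / 2}
  have hC (N : ℕ) : IsClosed (C N) := by
    have : C N = ⋂ n, ⋂ (_ : n ≥ N), Subtype.val ⁻¹'
        {φ : Lp ℝ 1 μ | (∀ᵐ t ∂μ, |φ t| ≤ 1) ∧ |∫ t, φ t * z n t ∂μ| ≤ ε / 2} := by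
      ext φ
      simp only [Set.mem_iInter, Set.mem_preimage, Set.mem_ofPred_eq, C]
      exact ⟨fun h n hn => ⟨φ.2, h n hn⟩, fun h n hn => (h n hn).2⟩
    rw [this]
    exact isClosed_iInter fun n => isClosed_iInter fun _ =>
      (isClosed_setOf_bounded_integral_mul_le (hzi n) _).preimage continuous_subtype_val
  have hU : ⋃ N, C N = Set.univ := by
    refine Set.eq_univ_of_forall fun φ => Set.mem_iUnion.2 ?_
    have hφm : Measurable ((φ : Lp ℝ 1 μ) : Ω → ℝ) := (Lp.stronglyMeasurable _).measurable
    obtain ⟨l, -, hl⟩ := exists_dual_of_bounded (μ := μ)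
      (g := fun t => max (-1) (min 1 ((φ : Lp ℝ 1 μ) t))) (R := 1)
      (measurable_const.max (measurable_const.min hφm)) zero_le_one
      (fun t => abs_le.2 ⟨le_max_left _ _, max_le (by norm_num) (min_le_left _ _)⟩)
    have hlz (n : ℕ) : l (z n) = ∫ t, (φ : Lp ℝ 1 μ) t * z n t ∂μ := by
      rw [hl]
      refine integral_congr_ae ?_
      filter_upwards [φ.2] with t ht
      rw [min_eq_right (abs_le.1 ht).2, max_eq_right (abs_le.1 ht).1]
    have h := (hz l).abs
    rw [abs_zero] at h
    obtain ⟨N, hN⟩ := eventually_atTop.1 (h.eventually (gt_mem_nhds (half_pos hε)))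
    exact ⟨N, fun n hn => by rw [← hlz]; exact (hN n hn).le⟩
  obtain ⟨N, φ₀, hφ₀⟩ := nonempty_interior_of_iUnion_of_closed hC hU
  obtain ⟨ρ, hρ, hball⟩ := Metric.isOpen_iff.1 isOpen_interior φ₀ hφ₀
  refine ⟨ρ / 4, by positivity, N, fun n hn B hB hμB => ?_⟩
  have hφ₀m : Measurable ((φ₀ : Lp ℝ 1 μ) : Ω → ℝ) := (Lp.stronglyMeasurable _).measurable
  have hφ₀i : Integrable (φ₀ : Lp ℝ 1 μ) μ := L1.integrable_coeFn _
  have key {σ : Ω → ℝ} (hσ : Measurable σ) (hσ1 : ∀ t, |σ t| ≤ 1) :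
      |∫ t in B, σ t * z n t ∂μ + ∫ t in Bᶜ, (φ₀ : Lp ℝ 1 μ) t * z n t ∂μ| ≤ ε / 2 := by
    classical
    set u : Ω → ℝ := B.piecewise σ (φ₀ : Lp ℝ 1 μ) with hu
    have hub : ∀ᵐ t ∂μ, |u t| ≤ 1 := by
      filter_upwards [φ₀.2] with t ht
      by_cases htB : t ∈ B
      · simpa [hu, htB] using hσ1 t
      · simpa [hu, htB] using ht
    have hum : Measurable u := hσ.piecewise hB hφ₀m
    have hui : Integrable u μ := Integrable.of_bound hum.aestronglyMeasurable 1 hub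
    have huK : hui.toL1 u ∈ K := by
      filter_upwards [hui.coeFn_toL1, hub] with t h1 h2
      rwa [h1]
    have hdist : dist (⟨hui.toL1 u, huK⟩ : K) φ₀ < ρ := by
      rw [Subtype.dist_eq, dist_eq_norm, L1.norm_eq_integral_norm]
      have : ∫ t, ‖(hui.toL1 u - (φ₀ : Lp ℝ 1 μ) : Lp ℝ 1 μ) t‖ ∂μ ≤ ∫ t, B.indicator 2 t ∂μ := by
        refine integral_mono_ae (L1.integrable_coeFn _).norm
          ((integrable_const (2 : ℝ)).indicator hB) ?_
        filter_upwards [hui.coeFn_toL1, φ₀.2, Lp.coeFn_sub (hui.toL1 u) φ₀] with t h1 h2 h3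
        rw [h3, Pi.sub_apply, h1]
        by_cases htB : t ∈ B
        · simp only [hu, htB, Set.piecewise_eq_of_mem, Set.indicator_of_mem, Pi.ofNat_apply]
          refine (norm_sub_le _ _).trans ?_
          have := hσ1 t
          simp only [Real.norm_eq_abs]
          linarith
        · simp [hu, htB]
      refine this.trans_lt ?_
      rw [integral_indicator hB]
      simp only [Pi.ofNat_apply, integral_const, smul_eq_mul, measureReal_restrict_apply_univ]
      linarith
    have hmem : (⟨hui.toL1 u, huK⟩ : K) ∈ C N := interior_subset (hball hdist)
    have h1 := hmem n hn
    have h2 : ∫ t, (hui.toL1 u) t * z n t ∂μ =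
        ∫ t in B, σ t * z n t ∂μ + ∫ t in Bᶜ, (φ₀ : Lp ℝ 1 μ) t * z n t ∂μ := by
      have huz : Integrable (fun t => u t * z n t) μ :=
        (hzi n).bdd_mul hum.aestronglyMeasurable hub
      calc _ = ∫ t, u t * z n t ∂μ := by
            refine integral_congr_ae ?_
            filter_upwards [hui.coeFn_toL1] with t ht
            rw [ht]
        _ = _ := by
            rw [← integral_add_compl hB huz]
            congr 1
            · exact setIntegral_congr_fun hB fun t ht => by simp [hu, ht]
            · exact setIntegral_congr_fun hB.compl fun t ht => by
                simp [hu, (show t ∉ B from ht)]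
    rwa [← h2]
  have hzm : Measurable (z n) := (Lp.stronglyMeasurable _).measurable
  have h1 := key (σ := fun t => if 0 ≤ z n t then 1 else -1)
    (Measurable.ite (measurableSet_le measurable_const hzm) measurable_const measurable_const)
    (fun t => by split_ifs <;> simp)
  have h2 := key (σ := 0) measurable_const (by simp)
  have h3 : ∫ t in B, |z n t| ∂μ = ∫ t in B, (if 0 ≤ z n t then 1 else -1) * z n t ∂μ := by
    congr 1 with t
    split_ifs with h
    · rw [abs_of_nonneg h, one_mul]
    · rw [abs_of_neg (not_le.1 h), neg_one_mul]
  rw [h3]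
  simp only [Pi.zero_apply, zero_mul, integral_zero, zero_add] at h2
  linarith [(abs_le.1 h1).2, (abs_le.1 h2).1]

/-- `b` selects, for every functional `y`, a bounded density representing `y ∘ T`. -/
structure IsDensity {X : Type*} [NormedAddCommGroup X] [NormedSpace ℝ X]
    (T : Lp ℝ 1 mu →L[ℝ] X) (b : (X →L[ℝ] ℝ) → ℝ → ℝ) : Prop where
  measurable : ∀ y, Measurable (b y)
  bound : ∀ y t, |b y t| ≤ ‖y‖ * ‖T‖
  apply_eq : ∀ y (f : Lp ℝ 1 mu), y (T f) = ∫ t, b y t * f t ∂mu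

theorem exists_isDensity {X : Type*} [NormedAddCommGroup X] [NormedSpace ℝ X]
    (T : Lp ℝ 1 mu →L[ℝ] X) : ∃ b, IsDensity T b := by
  choose b hb hbb hbe using fun y : X →L[ℝ] ℝ => exists_density (y.comp T)
  exact ⟨b, hb, fun y t => (hbb y t).trans (y.opNorm_comp_le T), hbe⟩

theorem integral_mul_toL1 {Ω : Type*} [MeasurableSpace Ω] {μ : Measure Ω} {f : Ω → ℝ}
    (hf : Integrable f μ) (u : Ω → ℝ) :
    ∫ t, u t * (hf.toL1 f) t ∂μ = ∫ t, u t * f t ∂μ := by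
  refine integral_congr_ae ?_
  filter_upwards [hf.coeFn_toL1] with t ht
  rw [ht]

theorem IsDensity.apply_toL1 {X : Type*} [NormedAddCommGroup X] [NormedSpace ℝ X]
    {T : Lp ℝ 1 mu →L[ℝ] X} {b : (X →L[ℝ] ℝ) → ℝ → ℝ} (hb : IsDensity T b) (y : X →L[ℝ] ℝ)
    {f : ℝ → ℝ} (hf : Integrable f mu) : y (T (hf.toL1 f)) = ∫ t, b y t * f t ∂mu := by
  rw [hb.apply_eq, integral_mul_toL1]

theorem IsDensity.integrable {X : Type*} [NormedAddCommGroup X] [NormedSpace ℝ X]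
    {T : Lp ℝ 1 mu →L[ℝ] X} {b : (X →L[ℝ] ℝ) → ℝ → ℝ} (hb : IsDensity T b) (y : X →L[ℝ] ℝ) :
    Integrable (b y) mu :=
  Integrable.of_bound (hb.measurable y).aestronglyMeasurable _ (Eventually.of_forall (hb.bound y))

theorem integral_abs_le_of_tendsto {Ω : Type*} [MeasurableSpace Ω] {μ : Measure Ω}
    {U : Filter ℕ} [U.NeBot] {g : ℕ → Ω → ℝ} {g₀ : Ω → ℝ} {ε : ℝ}
    (hg : ∀ σ : Ω → ℝ, Measurable σ → (∀ t, |σ t| ≤ 1) →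
      Tendsto (fun n => ∫ t, σ t * g n t ∂μ) U (𝓝 (∫ t, σ t * g₀ t ∂μ)))
    (hg₀ : Measurable g₀)
    (hε : ∀ σ : Ω → ℝ, Measurable σ → (∀ t, |σ t| ≤ 1) →
      ∀ᶠ n in U, |∫ t, σ t * g n t ∂μ| ≤ ε) :
    ∫ t, |g₀ t| ∂μ ≤ ε := by
  set σ : Ω → ℝ := fun t => if 0 ≤ g₀ t then 1 else -1
  have hσ : Measurable σ :=
    Measurable.ite (measurableSet_le measurable_const hg₀) measurable_const measurable_const
  have hσ1 (t : Ω) : |σ t| ≤ 1 := by simp only [σ]; split_ifs <;> simp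
  have h1 : ∫ t, |g₀ t| ∂μ = ∫ t, σ t * g₀ t ∂μ := by
    congr 1 with t
    simp only [σ]
    split_ifs with h
    · rw [abs_of_nonneg h, one_mul]
    · rw [abs_of_neg (not_le.1 h), neg_one_mul]
  rw [h1]
  exact (le_abs_self _).trans (le_of_tendsto (hg σ hσ hσ1).abs (hε σ hσ hσ1))

theorem exists_bounded_norm_of_weakly_null {E : Type*} [NormedAddCommGroup E] [NormedSpace ℝ E]
    {z : ℕ → E} (hz : ∀ l : E →L[ℝ] ℝ, Tendsto (fun n => l (z n)) atTop (𝓝 0)) :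
    ∃ M > 0, ∀ n, ‖z n‖ ≤ M := by
  obtain ⟨M, hM⟩ := banach_steinhaus (g := fun n => NormedSpace.inclusionInDoubleDual ℝ E (z n))
    fun l => by
      obtain ⟨C, hC⟩ := (hz l).norm.bddAbove_range
      exact ⟨C, fun n => by simpa using hC ⟨n, rfl⟩⟩
  refine ⟨|M| + 1, by positivity, fun n => ?_⟩
  have h1 : ‖z n‖ ≤ M := ((NormedSpace.inclusionInDoubleDualLi ℝ (E := E)).norm_map (z n)).symm.le.trans (hM n)
  exact h1.trans ((le_abs_self M).trans (by linarith))

/-- Truncation: an `L¹` weakly null sequence which is not null under `T` may be replaced by a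
sequence of uniformly bounded functions. -/
theorem exists_bounded_weakly_null {X : Type*} [NormedAddCommGroup X] [NormedSpace ℝ X]
    {T : Lp ℝ 1 mu →L[ℝ] X} (hT : ¬ CompletelyContinuous T) :
    ∃ (U : Ultrafilter ℕ) (g : ℕ → ℝ → ℝ) (hg : ∀ n, Integrable (g n) mu) (R δ : ℝ), 0 ≤ R ∧ 0 < δ ∧
      (∀ n, Measurable (g n)) ∧ (∀ n t, |g n t| ≤ R) ∧
      (∀ f : ℝ → ℝ, Integrable f mu → Tendsto (fun n => ∫ t, g n t * f t ∂mu) U (𝓝 0)) ∧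
      ∀ᶠ n in U, δ ≤ ‖T ((hg n).toL1 (g n))‖ := by
  simp only [CompletelyContinuous, not_forall] at hT
  obtain ⟨x, x₀, hx, hnot⟩ := hT
  set z : ℕ → Lp ℝ 1 mu := fun n => x n - x₀ with hz_def
  have hz (l : Lp ℝ 1 mu →L[ℝ] ℝ) : Tendsto (fun n => l (z n)) atTop (𝓝 0) := by
    simpa [hz_def] using (hx l).sub_const (l x₀)
  obtain ⟨δ, hδ, hfreq⟩ : ∃ δ > 0, ∃ᶠ n in atTop, δ ≤ ‖T (z n)‖ := by
    by_contra! hcon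
    apply hnot
    rw [tendsto_iff_norm_sub_tendsto_zero]
    refine squeeze_zero_norm' (a := fun n => ‖T (z n)‖) (Eventually.of_forall fun n => by simp [hz_def]) ?_
    rw [Metric.tendsto_nhds]
    intro ε hε
    filter_upwards [hcon ε hε] with n hn
    simpa using hn
  obtain ⟨M, hM, hzM⟩ := exists_bounded_norm_of_weakly_null hz
  have : (atTop ⊓ 𝓟 {n | δ ≤ ‖T (z n)‖}).NeBot := frequently_mem_iff_neBot.1 hfreq
  set U : Ultrafilter ℕ := Ultrafilter.of (atTop ⊓ 𝓟 {n | δ ≤ ‖T (z n)‖})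
  have hU1 : (U : Filter ℕ) ≤ atTop := (Ultrafilter.of_le _).trans inf_le_left
  have hU2 : ∀ᶠ n in U, δ ≤ ‖T (z n)‖ :=
    le_principal_iff.1 ((Ultrafilter.of_le (atTop ⊓ 𝓟 {n | δ ≤ ‖T (z n)‖})).trans inf_le_right)
  set ε := δ / (4 * (‖T‖ + 1)) with hε_def
  have hTn := norm_nonneg T
  have hε : 0 < ε := by positivity
  obtain ⟨r, hr, N, hN⟩ := equiintegrable_of_weakly_null hz hε
  set R := M / r with hR
  have hR0 : 0 < R := by positivity
  have hzm (n : ℕ) : Measurable (z n) := (Lp.stronglyMeasurable _).measurable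
  have hzi (n : ℕ) : Integrable (z n) mu := L1.integrable_coeFn _
  set B : ℕ → Set ℝ := fun n => {t | R < |z n t|}
  have hB (n : ℕ) : MeasurableSet (B n) := measurableSet_lt measurable_const (hzm n).abs
  have hμB (n : ℕ) : mu.real (B n) ≤ r := by
    have h1 := mul_meas_ge_le_integral_of_nonneg (μ := mu) (f := fun t => |z n t|)
      (Eventually.of_forall fun t => abs_nonneg _) (hzi n).abs R
    have h2 : ∫ t, |z n t| ∂mu ≤ M := by
      have := hzM n
      rwa [L1.norm_eq_integral_norm] at this
    have h3 : mu.real (B n) ≤ mu.real {t | R ≤ |z n t|} :=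
      measureReal_mono fun t (ht : R < |z n t|) => (le_of_lt ht : R ≤ |z n t|)
    have h4 : R * mu.real (B n) ≤ R * r := by
      have : R * r = M := by rw [hR]; field_simp
      rw [this]
      exact (mul_le_mul_of_nonneg_left h3 hR0.le).trans (h1.trans h2)
    exact le_of_mul_le_mul_left h4 hR0
  set q : ℕ → ℝ → ℝ := fun n => (B n)ᶜ.indicator (z n)
  have hqm (n : ℕ) : Measurable (q n) := (hzm n).indicator (hB n).compl
  have hqR (n : ℕ) (t : ℝ) : |q n t| ≤ R := by
    by_cases ht : t ∈ B n
    · simp [q, ht, hR0.le]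
    · simpa [q, ht] using (not_lt.1 ht)
  have hdiff (n : ℕ) (t : ℝ) : z n t - q n t = (B n).indicator (z n) t := by
    by_cases ht : t ∈ B n <;> simp [q, ht]
  have hqi (n : ℕ) : Integrable (q n) mu := (hzi n).indicator (hB n).compl
  obtain ⟨q₀, hq₀m, hq₀R, hq₀⟩ := exists_weak_limit (μ := mu) U hqm hqR hR0.le
  have hq₀i : Integrable q₀ mu :=
    Integrable.of_bound hq₀m.aestronglyMeasurable R (Eventually.of_forall hq₀R)
  have hIB {n : ℕ} (hn : n ≥ N) : ∫ t, |z n t - q n t| ∂mu ≤ ε := by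
    have : ∀ t, |z n t - q n t| = (B n).indicator (fun t => |z n t|) t := fun t => by
      rw [hdiff]
      by_cases ht : t ∈ B n <;> simp [ht]
    simp only [this]
    rw [integral_indicator (hB n)]
    exact hN n hn _ (hB n) (hμB n)
  have hσi {σ : ℝ → ℝ} (hσ : Measurable σ) (hσ1 : ∀ t, |σ t| ≤ 1) : Integrable σ mu :=
    Integrable.of_bound hσ.aestronglyMeasurable 1 (Eventually.of_forall hσ1)
  have hσz {σ : ℝ → ℝ} (hσ : Measurable σ) (hσ1 : ∀ t, |σ t| ≤ 1) :
      Tendsto (fun n => ∫ t, σ t * z n t ∂mu) U (𝓝 0) := by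
    obtain ⟨l, -, hl⟩ := exists_dual_of_bounded (μ := mu) hσ zero_le_one hσ1
    simpa only [hl] using (hz l).mono_left hU1
  have hq₀abs : ∫ t, |q₀ t| ∂mu ≤ ε := by
    refine integral_abs_le_of_tendsto (U := U) (g := fun n t => q n t - z n t) (fun σ hσ hσ1 => ?_)
      hq₀m (fun σ hσ hσ1 => ?_)
    · have h1 := (hq₀ σ (hσi hσ hσ1)).sub (hσz hσ hσ1)
      have h2 : ∫ t, q₀ t * σ t ∂mu = ∫ t, σ t * q₀ t ∂mu := by simp only [mul_comm]
      rw [sub_zero, h2] at h1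
      refine h1.congr fun n => ?_
      rw [← integral_sub (integrable_mul_of_bounded (hqm n) (hqR n) (hσi hσ hσ1))
        (integrable_mul_of_bounded hσ hσ1 (hzi n))]
      exact integral_congr_ae (Eventually.of_forall fun t => by ring)
    · filter_upwards [hU1 (eventually_ge_atTop N)] with n hn
      refine le_trans ?_ (hIB hn)
      refine norm_integral_le_of_norm_le (f := fun t => σ t * (q n t - z n t))
        (show Integrable (fun t => |z n t - q n t|) mu from ((hzi n).sub (hqi n)).abs)
        (Eventually.of_forall fun t => ?_)
      rw [norm_mul, Real.norm_eq_abs, Real.norm_eq_abs, abs_sub_comm]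
      exact mul_le_of_le_one_left (abs_nonneg _) (hσ1 t)
  have hgi (n : ℕ) : Integrable (fun t => q n t - q₀ t) mu := (hqi n).sub hq₀i
  refine ⟨U, fun n t => q n t - q₀ t, hgi, R + R, δ / 2, by positivity, by positivity,
    fun n => (hqm n).sub hq₀m, fun n t => (abs_sub _ _).trans (add_le_add (hqR n t) (hq₀R t)),
    fun f hf => ?_, ?_⟩
  · have h1 := (hq₀ f hf).sub_const (∫ t, q₀ t * f t ∂mu)
    rw [sub_self] at h1
    refine h1.congr fun n => ?_
    rw [← integral_sub (integrable_mul_of_bounded (hqm n) (hqR n) hf)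
      (integrable_mul_of_bounded hq₀m hq₀R hf)]
    simp only [sub_mul]
  · filter_upwards [hU1 (eventually_ge_atTop N), hU2] with n hn hn2
    have h1 : ‖z n - (hgi n).toL1 _‖ ≤ ε + ε := by
      rw [L1.norm_eq_integral_norm]
      calc ∫ t, ‖(z n - (hgi n).toL1 _ : Lp ℝ 1 mu) t‖ ∂mu
          = ∫ t, |(z n t - q n t) + q₀ t| ∂mu := by
            refine integral_congr_ae ?_
            filter_upwards [Lp.coeFn_sub (z n) ((hgi n).toL1 _), (hgi n).coeFn_toL1] with t h1 h2
            rw [h1, Pi.sub_apply, h2, Real.norm_eq_abs]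
            congr 1
            ring
        _ ≤ ∫ t, (|z n t - q n t| + |q₀ t|) ∂mu :=
            integral_mono (((hzi n).sub (hqi n)).add hq₀i).abs
              (((hzi n).sub (hqi n)).abs.add hq₀i.abs) fun t => abs_add_le _ _
        _ = ∫ t, |z n t - q n t| ∂mu + ∫ t, |q₀ t| ∂mu :=
            integral_add ((hzi n).sub (hqi n)).abs hq₀i.abs
        _ ≤ ε + ε := add_le_add (hIB hn) hq₀abs
    have h2 : ‖T (z n) - T ((hgi n).toL1 _)‖ ≤ δ / 2 := by
      rw [← map_sub]
      refine (T.le_opNorm_of_le h1).trans ?_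
      rw [hε_def]
      have : ‖T‖ * (δ / (4 * (‖T‖ + 1)) + δ / (4 * (‖T‖ + 1))) = δ / 2 * (‖T‖ / (‖T‖ + 1)) := by
        field_simp
        ring
      rw [this]
      exact mul_le_of_le_one_right (by positivity) ((div_le_one (by positivity)).2 (by linarith))
    have h3 := norm_sub_norm_le (T (z n)) (T ((hgi n).toL1 _))
    linarith

theorem exists_weakly_null_pairing {X : Type*} [NormedAddCommGroup X] [NormedSpace ℝ X]
    {T : Lp ℝ 1 mu →L[ℝ] X} (hT : ¬ CompletelyContinuous T)
    {b : (X →L[ℝ] ℝ) → ℝ → ℝ} (hb : IsDensity T b) :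
    ∃ (U : Ultrafilter ℕ) (g : ℕ → ℝ → ℝ) (y : ℕ → X →L[ℝ] ℝ) (R δ : ℝ), 0 ≤ R ∧ 0 < δ ∧
      (∀ n, Measurable (g n)) ∧ (∀ n t, |g n t| ≤ R) ∧
      (∀ f : ℝ → ℝ, Integrable f mu → Tendsto (fun n => ∫ t, g n t * f t ∂mu) U (𝓝 0)) ∧
      (∀ n, ‖y n‖ ≤ 2) ∧
      (∀ f : ℝ → ℝ, Integrable f mu → Tendsto (fun n => ∫ t, b (y n) t * f t ∂mu) U (𝓝 0)) ∧
      ∀ᶠ n in U, δ ≤ ∫ t, b (y n) t * g n t ∂mu := by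
  obtain ⟨U, g, hgi, R, δ, hR, hδ, hgm, hgR, hg0, hgT⟩ := exists_bounded_weakly_null hT
  choose y hy1 hyg using fun n => exists_dual_vector'' ℝ (T ((hgi n).toL1 (g n)))
  obtain ⟨y₀, hy₀, hlim⟩ := exists_weakStar_limit U hy1
  refine ⟨U, g, fun n => y n - y₀, R, δ / 2, hR, by positivity, hgm, hgR, hg0, fun n => ?_,
    fun f hf => ?_, ?_⟩
  · exact (norm_sub_le _ _).trans (by linarith [hy1 n])
  · have h1 := (hlim (T (hf.toL1 f))).sub_const (y₀ (T (hf.toL1 f)))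
    rw [sub_self] at h1
    refine h1.congr fun n => ?_
    rw [← hb.apply_toL1, sub_apply]
  · have h1 := hg0 (b y₀) (hb.integrable y₀)
    filter_upwards [hgT, h1.eventually (gt_mem_nhds (half_pos hδ))] with n hn hn2
    rw [← hb.apply_toL1 _ (hgi n), sub_apply, hyg, hb.apply_toL1]
    simp only [mul_comm] at hn2 ⊢
    simp only [RCLike.ofReal_real_eq_id, id_eq]
    linarith

theorem setIntegral_eq_integral_indicator_mul {Ω : Type*} [MeasurableSpace Ω] {μ : Measure Ω}
    {F : Set Ω} (hF : MeasurableSet F) (f : Ω → ℝ) :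
    ∫ t in F, f t ∂μ = ∫ t, f t * F.indicator (fun _ => (1 : ℝ)) t ∂μ := by
  rw [← integral_indicator hF]
  congr 1 with t
  by_cases ht : t ∈ F <;> simp [ht]

/-- A weakly null bounded sequence of functions may be perturbed by a norm null sequence so as to
become orthogonal to finitely many integrable functions. -/
theorem exists_orthogonal_correction {Ω ι : Type*} [MeasurableSpace Ω] {μ : Measure Ω}
    [IsFiniteMeasure μ] [Finite ι] {U : Filter ℕ} {g : ℕ → Ω → ℝ} {R : ℝ} (h0 : 0 ≤ R)
    (hg : ∀ n, Measurable (g n)) (hR : ∀ n t, |g n t| ≤ R) {f : ι → Ω → ℝ}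
    (hf : ∀ i, Integrable (f i) μ)
    (hnull : ∀ i, Tendsto (fun n => ∫ t, g n t * f i t ∂μ) U (𝓝 0)) :
    ∃ g' : ℕ → Ω → ℝ, (∀ n, Measurable (g' n)) ∧ (∀ᶠ n in U, ∀ t, |g' n t| ≤ R + 1) ∧
      (∀ n i, ∫ t, g' n t * f i t ∂μ = 0) ∧
      ∃ ε : ℕ → ℝ, Tendsto ε U (𝓝 0) ∧ ∀ n (q : Ω → ℝ), Integrable q μ →
        |∫ t, g' n t * q t ∂μ - ∫ t, g n t * q t ∂μ| ≤ ε n * ∫ t, |q t| ∂μ := by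
  have := Fintype.ofFinite ι
  choose γ hγ hγg using fun n => exists_dual_of_bounded (μ := μ) (hg n) h0 (hR n)
  obtain ⟨w, hw, hw0⟩ := exists_tendsto_zero_correction (U := U) (v := γ)
    (fun i => ContinuousLinearMap.apply ℝ ℝ ((hf i).toL1 (f i))) fun i => by
      simpa only [ContinuousLinearMap.apply_apply, hγg, integral_mul_toL1] using hnull i
  choose g' hg'm hg'b hg' using fun n => exists_density (γ n - w n)
  refine ⟨g', hg'm, ?_, fun n i => ?_, fun n => ‖w n‖, by simpa using hw0.norm, fun n q hq => ?_⟩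
  · filter_upwards [hw0.norm.eventually (gt_mem_nhds (by simp : ‖(0 : Lp ℝ 1 μ →L[ℝ] ℝ)‖ < 1))]
      with n hn t
    exact (hg'b n t).trans ((norm_sub_le _ _).trans (add_le_add (hγ n) hn.le))
  · rw [← integral_mul_toL1 (hf i), ← hg', sub_apply, sub_eq_zero]
    exact (hw n i).symm
  · rw [← integral_mul_toL1 hq, ← integral_mul_toL1 hq, ← hg', ← hγg, sub_apply, sub_sub_cancel_left,
      abs_neg]
    refine ((w n).le_opNorm _).trans_eq ?_
    rw [L1.norm_eq_integral_norm]
    congr 1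
    refine integral_congr_ae ?_
    filter_upwards [hq.coeFn_toL1] with t ht
    rw [ht, Real.norm_eq_abs]

/-- A functional-valued analogue of `exists_orthogonal_correction`. -/
theorem IsDensity.exists_orthogonal_correction {X ι : Type*} [NormedAddCommGroup X]
    [NormedSpace ℝ X] [Finite ι] {T : Lp ℝ 1 mu →L[ℝ] X} {b : (X →L[ℝ] ℝ) → ℝ → ℝ}
    (hb : IsDensity T b) {U : Filter ℕ} {y : ℕ → X →L[ℝ] ℝ} {C : ℝ} (hy : ∀ n, ‖y n‖ ≤ C)
    {f : ι → ℝ → ℝ} (hf : ∀ i, Integrable (f i) mu)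
    (hnull : ∀ i, Tendsto (fun n => ∫ t, b (y n) t * f i t ∂mu) U (𝓝 0)) :
    ∃ y' : ℕ → X →L[ℝ] ℝ, (∀ᶠ n in U, ‖y' n‖ ≤ C + 1) ∧
      (∀ n i, ∫ t, b (y' n) t * f i t ∂mu = 0) ∧
      ∃ ε : ℕ → ℝ, Tendsto ε U (𝓝 0) ∧ ∀ n (q : ℝ → ℝ), Integrable q mu →
        |∫ t, b (y' n) t * q t ∂mu - ∫ t, b (y n) t * q t ∂mu| ≤ ε n * ∫ t, |q t| ∂mu := by
  have := Fintype.ofFinite ι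
  obtain ⟨w, hw, hw0⟩ := exists_tendsto_zero_correction (U := U) (v := y)
    (fun i => ContinuousLinearMap.apply ℝ ℝ (T ((hf i).toL1 (f i)))) fun i => by
      simpa [hb.apply_toL1] using hnull i
  refine ⟨fun n => y n - w n, ?_, fun n i => ?_, fun n => ‖w n‖ * ‖T‖,
    by simpa using hw0.norm.mul_const ‖T‖, fun n q hq => ?_⟩
  · filter_upwards [hw0.norm.eventually (gt_mem_nhds (by simp : ‖(0 : X →L[ℝ] ℝ)‖ < 1))] with n hn
    exact (norm_sub_le _ _).trans (add_le_add (hy n) hn.le)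
  · rw [← hb.apply_toL1 _ (hf i), sub_apply, sub_eq_zero]
    exact (hw n i).symm
  · rw [← hb.apply_toL1 _ hq, ← hb.apply_toL1 _ hq, sub_apply, sub_sub_cancel_left, abs_neg]
    refine ((w n).le_opNorm _).trans ?_
    rw [mul_assoc]
    refine mul_le_mul_of_nonneg_left ((T.le_opNorm _).trans_eq ?_) (norm_nonneg _)
    rw [L1.norm_eq_integral_norm]
    congr 1
    refine integral_congr_ae ?_
    filter_upwards [hq.coeFn_toL1] with t ht
    rw [ht, Real.norm_eq_abs]

theorem exists_stage_of_pairing {X K ι : Type*} [NormedAddCommGroup X] [NormedSpace ℝ X]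
    [Fintype K] [Finite ι] {T : Lp ℝ 1 mu →L[ℝ] X} {b : (X →L[ℝ] ℝ) → ℝ → ℝ}
    (hb : IsDensity T b) {y' : X →L[ℝ] ℝ} {g' : ℝ → ℝ} {C r δ : ℝ} (hr : 0 < r) (hδ : 0 < δ)
    (hy' : ‖y'‖ ≤ C) (hgm : Measurable g') (hgr : ∀ t, |g' t| ≤ r)
    {F : K → Set ℝ} (hF : ∀ k, MeasurableSet (F k)) (hdisj : Pairwise (Function.onFun Disjoint F))
    {h : ι → ℝ → ℝ} (hh : ∀ i, Integrable (h i) mu)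
    (hg0 : ∀ k i, ∫ t in F k, g' t * h i t ∂mu = 0) (hb0 : ∀ k, ∫ t in F k, b y' t ∂mu = 0)
    (hpair : ∀ k, δ * mu.real (F k) ≤ ∫ t in F k, g' t * b y' t ∂mu) :
    ∃ (y : X →L[ℝ] ℝ) (φ : ℝ → ℝ), ‖y‖ ≤ r / δ * C ∧ Measurable φ ∧ (∀ t, φ t = 1 ∨ φ t = -1) ∧
      (∀ k i, ∫ t in F k, φ t * h i t ∂mu = 0) ∧ (∀ k, ∫ t in F k, b y t ∂mu = 0) ∧
      ∀ k, ∫ t in F k, φ t * b y t ∂mu = mu.real (F k) := by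
  set D := r / δ with hD
  have hD0 : 0 < D := by positivity
  set v : K → ℝ := fun k => ∫ t in F k, g' t * b y' t ∂mu with hv
  set c : K → ℝ := fun k => mu.real (F k) / v k with hc
  have hv0 (k : K) : 0 ≤ v k := (by positivity : 0 ≤ δ * mu.real (F k)).trans (hpair k)
  have hcv (k : K) : c k * v k = mu.real (F k) := by
    rcases (hv0 k).eq_or_lt with h0 | h0
    · have h1 : mu.real (F k) ≤ 0 := by
        have this : δ * mu.real (F k) ≤ v k := hpair k
        rw [← h0] at this
        exact nonpos_of_mul_nonpos_right this hδ
      rw [← h0, mul_zero]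
      exact (le_antisymm h1 measureReal_nonneg).symm
    · exact div_mul_cancel₀ _ h0.ne'
  have hc0 (k : K) : 0 ≤ c k := div_nonneg measureReal_nonneg (hv0 k)
  have hcδ (k : K) : c k ≤ 1 / δ := by
    refine div_le_of_le_mul₀ (hv0 k) (by positivity) ?_
    rw [one_div, inv_mul_eq_div, le_div_iff₀ hδ, mul_comm]
    exact hpair k
  set a : ℝ → ℝ := fun t => ∑ k, (F k).indicator (fun _ => c k) t with ha
  have ham : Measurable a :=
    Finset.measurable_sum _ fun k _ => measurable_const.indicator (hF k)
  have haF {k : K} {t : ℝ} (ht : t ∈ F k) : a t = c k := by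
    simp only [ha]
    rw [Finset.sum_eq_single k, Set.indicator_of_mem ht]
    · intro j _ hj
      exact Set.indicator_of_notMem (fun htj => Set.disjoint_left.1 (hdisj hj) htj ht) _
    · simp
  have haδ (t : ℝ) : |a t| ≤ 1 / δ := by
    by_cases ht : ∃ k, t ∈ F k
    · obtain ⟨k, hk⟩ := ht
      rw [haF hk, abs_of_nonneg (hc0 k)]
      exact hcδ k
    · push Not at ht
      have : a t = 0 := Finset.sum_eq_zero fun k _ => Set.indicator_of_notMem (ht k) _
      rw [this, abs_zero]
      positivity
  set φ₀ : ℝ → ℝ := fun t => D⁻¹ * (a t * g' t) with hφ₀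
  have hφ₀m : Measurable φ₀ := (ham.mul hgm).const_mul _
  have hφ₀1 (t : ℝ) : |φ₀ t| ≤ 1 := by
    simp only [hφ₀, abs_mul]
    rw [abs_of_pos (inv_pos.2 hD0), inv_mul_le_iff₀ hD0, mul_one]
    calc |a t| * |g' t| ≤ 1 / δ * r :=
          mul_le_mul (haδ t) (hgr t) (abs_nonneg _) (by positivity)
      _ = D := by rw [hD]; ring
  set y : X →L[ℝ] ℝ := D • y' with hy
  have hby (q : ℝ → ℝ) (hq : Integrable q mu) :
      ∫ t, b y t * q t ∂mu = D * ∫ t, b y' t * q t ∂mu := by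
    rw [← hb.apply_toL1 _ hq, ← hb.apply_toL1 _ hq]
    rfl
  set χ : K → ℝ → ℝ := fun k => (F k).indicator fun _ => (1 : ℝ) with hχ
  have hχm (k : K) : Measurable (χ k) := measurable_const.indicator (hF k)
  have hχ1 (k : K) (t : ℝ) : |χ k t| ≤ 1 := by
    by_cases ht : t ∈ F k <;> simp [hχ, ht]
  have hχi (k : K) {q : ℝ → ℝ} (hq : Integrable q mu) : Integrable (fun t => χ k t * q t) mu :=
    integrable_mul_of_bounded (hχm k) (hχ1 k) hq
  obtain ⟨φ, hφm, hφ1, hφ⟩ := exists_sign_function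
    (h := fun j : (K × ι) ⊕ K => Sum.elim (fun p => fun t => χ p.1 t * h p.2 t)
      (fun k => fun t => χ k t * b y t) j)
    (by rintro (p | k)
        · exact hχi _ (hh _)
        · exact hχi _ (hb.integrable y)) hφ₀m hφ₀1
  have hset (k : K) (q : ℝ → ℝ) : ∫ t in F k, q t ∂mu = ∫ t, q t * χ k t ∂mu :=
    setIntegral_eq_integral_indicator_mul (hF k) q
  have hφ₀χ (k : K) (q : ℝ → ℝ) :
      ∫ t, φ₀ t * (χ k t * q t) ∂mu = D⁻¹ * c k * ∫ t in F k, g' t * q t ∂mu := by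
    rw [hset, ← integral_const_mul]
    congr 1 with t
    by_cases ht : t ∈ F k
    · simp only [hφ₀, haF ht]
      ring
    · simp [hχ, ht]
  refine ⟨y, φ, ?_, hφm, hφ1, fun k i => ?_, fun k => ?_, fun k => ?_⟩
  · rw [hy, norm_smul, Real.norm_of_nonneg hD0.le]
    exact mul_le_mul_of_nonneg_left hy' hD0.le
  · have := hφ (Sum.inl (k, i))
    simp only [Sum.elim_inl] at this
    rw [hφ₀χ, hg0, mul_zero] at this
    rw [hset, ← this]
    congr 1 with t
    ring
  · have h1 : Integrable (χ k) mu :=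
      Integrable.of_bound (hχm k).aestronglyMeasurable 1 (Eventually.of_forall (hχ1 k))
    rw [hset, hby _ h1, ← hset, hb0, mul_zero]
  · have := hφ (Sum.inr k)
    simp only [Sum.elim_inr] at this
    rw [hφ₀χ] at this
    have h2 : ∫ t in F k, g' t * b y t ∂mu = D * v k := by
      have hq : Integrable (fun t => g' t * χ k t) mu :=
        integrable_mul_of_bounded hgm hgr
          (Integrable.of_bound (hχm k).aestronglyMeasurable 1 (Eventually.of_forall (hχ1 k)))
      have h3 (z : X →L[ℝ] ℝ) :
          ∫ t in F k, g' t * b z t ∂mu = ∫ t, b z t * (g' t * χ k t) ∂mu := by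
        rw [hset]
        congr 1 with t
        ring
      rw [h3, hby _ hq, ← h3]
    rw [h2] at this
    have h4 : D⁻¹ * c k * (D * v k) = mu.real (F k) := by
      rw [← hcv k]
      field_simp
    rw [hset, ← h4, ← this]
    congr 1 with t
    ring

/-- Rademacher-like behaviour of `φ` on each of the sets `F k`, reproduced by the density of `y`. -/
theorem exists_stage {X : Type*} [NormedAddCommGroup X] [NormedSpace ℝ X]
    {T : Lp ℝ 1 mu →L[ℝ] X} (hT : ¬ CompletelyContinuous T)
    {b : (X →L[ℝ] ℝ) → ℝ → ℝ} (hb : IsDensity T b) :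
    ∃ (E : Set ℝ) (C : ℝ), MeasurableSet E ∧ mu E ≠ 0 ∧
      ∀ {K ι : Type} [Fintype K] [Finite ι] (F : K → Set ℝ) (h : ι → ℝ → ℝ),
        (∀ k, MeasurableSet (F k)) → (∀ k, F k ⊆ E) → Pairwise (Function.onFun Disjoint F) →
        (∀ i, Integrable (h i) mu) →
        ∃ (y : X →L[ℝ] ℝ) (φ : ℝ → ℝ), ‖y‖ ≤ C ∧ Measurable φ ∧ (∀ t, φ t = 1 ∨ φ t = -1) ∧
          (∀ k i, ∫ t in F k, φ t * h i t ∂mu = 0) ∧ (∀ k, ∫ t in F k, b y t ∂mu = 0) ∧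
          ∀ k, ∫ t in F k, φ t * b y t ∂mu = mu.real (F k) := by
  obtain ⟨U, g, y, R, δ, hR, hδ, hgm, hgR, hg0, hy2, hy0, hpair⟩ := exists_weakly_null_pairing hT hb
  have hby (n : ℕ) (t : ℝ) : |b (y n) t * g n t| ≤ 2 * ‖T‖ * R := by
    rw [abs_mul]
    exact mul_le_mul ((hb.bound _ t).trans (mul_le_mul_of_nonneg_right (hy2 n) (norm_nonneg T)))
      (hgR n t) (abs_nonneg _) (by positivity)
  obtain ⟨β, hβm, hβb, hβ⟩ := exists_weak_limit (μ := mu) U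
    (fun n => (hb.measurable (y n)).mul (hgm n)) hby (by positivity)
  have hβi : Integrable β mu :=
    Integrable.of_bound hβm.aestronglyMeasurable _ (Eventually.of_forall hβb)
  have hβδ : δ ≤ ∫ t, β t ∂mu := by
    have h1 := hβ (fun _ => 1) (integrable_const 1)
    simp only [mul_one] at h1
    exact ge_of_tendsto h1 hpair
  set E : Set ℝ := {t | δ / 2 < β t} with hE
  refine ⟨E, (R + 1) / (δ / 4) * 3, measurableSet_lt measurable_const hβm, fun hE0 => ?_, ?_⟩
  · have h1 : ∫ t, β t ∂mu ≤ ∫ _, δ / 2 ∂mu := by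
      refine integral_mono_ae hβi (integrable_const _) ?_
      filter_upwards [measure_eq_zero_iff_ae_notMem.1 hE0] with t ht
      exact not_lt.1 ht
    simp only [integral_const, probReal_univ, one_smul] at h1
    linarith
  intro K ι _ _ F h hF hFE hdisj hh
  set χ : K → ℝ → ℝ := fun k => (F k).indicator fun _ => (1 : ℝ) with hχ
  have hχm (k : K) : Measurable (χ k) := measurable_const.indicator (hF k)
  have hχ1 (k : K) (t : ℝ) : |χ k t| ≤ 1 := by
    by_cases ht : t ∈ F k <;> simp [hχ, ht]
  have hχi (k : K) : Integrable (χ k) mu :=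
    Integrable.of_bound (hχm k).aestronglyMeasurable 1 (Eventually.of_forall (hχ1 k))
  have hχq (k : K) {q : ℝ → ℝ} (hq : Integrable q mu) : Integrable (fun t => χ k t * q t) mu :=
    integrable_mul_of_bounded (hχm k) (hχ1 k) hq
  have hset (k : K) (q : ℝ → ℝ) : ∫ t in F k, q t ∂mu = ∫ t, q t * χ k t ∂mu :=
    setIntegral_eq_integral_indicator_mul (hF k) q
  obtain ⟨g', hg'm, hg'R, hg'0, ε, hε, hg'ε⟩ := exists_orthogonal_correction (μ := mu) (U := U) hR
    hgm hgR (f := fun p : K × ι => fun t => χ p.1 t * h p.2 t) (fun p => hχq _ (hh _))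
    (fun p => hg0 _ (hχq _ (hh _)))
  obtain ⟨y', hy'3, hy'0, η, hη, hy'η⟩ := hb.exists_orthogonal_correction (U := U) hy2 (f := χ)
    hχi (fun k => hy0 _ (hχi k))
  have hlim (k : K) : Tendsto (fun n => ∫ t in F k, g' n t * b (y' n) t ∂mu) U
      (𝓝 (∫ t in F k, β t ∂mu)) := by
    have h1 : Tendsto (fun n => ∫ t, b (y n) t * (g n t * χ k t) ∂mu) U
        (𝓝 (∫ t in F k, β t ∂mu)) := by
      rw [hset]
      exact (hβ (χ k) (hχi k)).congr fun n =>
        integral_congr_ae (Eventually.of_forall fun t => mul_assoc _ _ _)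
    have hgχ (n : ℕ) : Integrable (fun t => g n t * χ k t) mu :=
      integrable_mul_of_bounded (hgm n) (hgR n) (hχi k)
    have h2 : Tendsto (fun n => ∫ t, b (y' n) t * (g n t * χ k t) ∂mu -
        ∫ t, b (y n) t * (g n t * χ k t) ∂mu) U (𝓝 0) := by
      have hz : Tendsto (fun n => |η n| * R) U (𝓝 0) := by simpa using hη.abs.mul_const R
      refine squeeze_zero_norm (fun n => ?_) hz
      refine (hy'η n _ (hgχ n)).trans (mul_le_mul (le_abs_self _) ?_ (by positivity) (abs_nonneg _))
      have : ∫ t, |g n t * χ k t| ∂mu ≤ ∫ _, R ∂mu := by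
        refine integral_mono (hgχ n).abs (integrable_const R) fun t => ?_
        simp only [abs_mul]
        exact (mul_le_of_le_one_right (abs_nonneg _) (hχ1 k t)).trans (hgR n t)
      simpa using this
    have h3 : Tendsto (fun n => ∫ t, g' n t * (b (y' n) t * χ k t) ∂mu -
        ∫ t, g n t * (b (y' n) t * χ k t) ∂mu) U (𝓝 0) := by
      have hz : Tendsto (fun n => |ε n| * (3 * ‖T‖)) U (𝓝 0) := by
        simpa using hε.abs.mul_const (3 * ‖T‖)
      refine squeeze_zero_norm' ?_ hz
      filter_upwards [hy'3] with n hn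
      have hbi : Integrable (fun t => b (y' n) t * χ k t) mu :=
        integrable_mul_of_bounded (hb.measurable _) (hb.bound _) (hχi k)
      refine (hg'ε n _ hbi).trans (mul_le_mul (le_abs_self _) ?_ (by positivity) (abs_nonneg _))
      have : ∫ t, |b (y' n) t * χ k t| ∂mu ≤ ∫ _, 3 * ‖T‖ ∂mu := by
        refine integral_mono hbi.abs (integrable_const _) fun t => ?_
        simp only [abs_mul]
        refine (mul_le_of_le_one_right (abs_nonneg _) (hχ1 k t)).trans ((hb.bound _ t).trans ?_)
        exact mul_le_mul_of_nonneg_right (hn.trans (by norm_num)) (norm_nonneg T)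
      simpa using this
    have h4 := (h1.add h2).add h3
    rw [add_zero, add_zero] at h4
    refine h4.congr fun n => ?_
    rw [hset]
    have e1 : ∫ t, b (y' n) t * (g n t * χ k t) ∂mu = ∫ t, g n t * (b (y' n) t * χ k t) ∂mu := by
      congr 1 with t
      ring
    rw [e1, add_sub_cancel, add_sub_cancel]
    simp only [mul_assoc]
  have hlow (k : K) : ∀ᶠ n in U, δ / 4 * mu.real (F k) ≤ ∫ t in F k, g' n t * b (y' n) t ∂mu := by
    have h1 : δ / 2 * mu.real (F k) ≤ ∫ t in F k, β t ∂mu := by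
      have := setIntegral_mono_on (μ := mu) (s := F k) (f := fun _ => δ / 2) (g := β)
        (integrable_const _).integrableOn hβi.integrableOn (hF k) fun t ht => (hFE k ht).le
      simpa [mul_comm] using this
    rcases (measureReal_nonneg (μ := mu) (s := F k)).eq_or_lt with h0 | h0
    · have hz : mu (F k) = 0 := (measureReal_eq_zero_iff).1 h0.symm
      refine Eventually.of_forall fun n => ?_
      rw [← h0, mul_zero, Measure.restrict_eq_zero.2 hz, integral_zero_measure]
    · refine ((hlim k).eventually (lt_mem_nhds ?_)).mono fun n hn => hn.le
      refine lt_of_lt_of_le ?_ h1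
      exact mul_lt_mul_of_pos_right (by linarith) h0
  obtain ⟨n, hn1, hn2, hn3⟩ := (hg'R.and (hy'3.and (eventually_all.2 hlow))).exists
  refine exists_stage_of_pairing hb (by positivity) (by positivity)
    (hn2.trans (by norm_num)) (hg'm n) hn1 hF hdisj hh (fun k i => ?_) (fun k => ?_) hn3
  · rw [hset, ← hg'0 n (k, i)]
    congr 1 with t
    ring
  · rw [hset, hy'0]

theorem setIntegral_inter_sign {Ω : Type*} [MeasurableSpace Ω] {μ : Measure Ω} {S : Set Ω}
    {φ q : Ω → ℝ} (hφm : Measurable φ) (hφ : ∀ t, φ t = 1 ∨ φ t = -1)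
    (hq : Integrable q μ) {s : ℝ} (hs : s = 1 ∨ s = -1) :
    ∫ t in S ∩ {t | φ t = s}, q t ∂μ =
      ((∫ t in S, q t ∂μ) + s * ∫ t in S, φ t * q t ∂μ) / 2 := by
  have hφq : Integrable (fun t => φ t * q t) μ :=
    integrable_mul_of_bounded (R := 1) hφm
      (fun t => by rcases hφ t with h | h <;> simp [h]) hq
  have hm : MeasurableSet {t | φ t = s} := hφm (measurableSet_singleton s)
  rw [← setIntegral_indicator hm,
    ← integral_const_mul, ← integral_add hq.integrableOn (hφq.integrableOn.const_mul s),
    ← integral_div]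
  congr 1 with t
  rcases hφ t with h | h <;> rcases hs with rfl | rfl <;>
    simp [Set.indicator_apply, h] <;> norm_num

theorem setIntegral_dyadic_child {Ω : Type*} [MeasurableSpace Ω] {μ : Measure Ω} {F : Set Ω}
    {κ κ' : Ω → ℕ} {q : Ω → ℝ} (hκ' : Measurable κ') (hq : Integrable q μ)
    (hstep : ∀ t, κ' t = 2 * κ t ∨ κ' t = 2 * κ t + 1) (k : ℕ) :
    ∫ t in F ∩ {t | κ' t = k}, q t ∂μ = ((∫ t in F ∩ {t | κ t = k / 2}, q t ∂μ) +
      (-1) ^ k * ∫ t in F ∩ {t | κ t = k / 2}, (-1) ^ κ' t * q t ∂μ) / 2 := by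
  have hset : F ∩ {t | κ' t = k} =
      (F ∩ {t | κ t = k / 2}) ∩ {t | (-1 : ℝ) ^ κ' t = (-1) ^ k} := by
    ext t
    simp only [Set.mem_inter_iff, Set.mem_ofPred_eq, and_assoc]
    refine and_congr_right fun _ => ⟨?_, ?_⟩
    · rintro rfl
      exact ⟨by have := hstep t; omega, rfl⟩
    · rintro ⟨h1, h2⟩
      have h3 : Even (κ' t) ↔ Even k := by
        rw [← neg_one_pow_eq_one_iff_even (R := ℝ) (by norm_num), h2,
          neg_one_pow_eq_one_iff_even (by norm_num)]
      have := hstep t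
      rw [Nat.even_iff, Nat.even_iff] at h3
      omega
  rw [hset]
  exact setIntegral_inter_sign (measurable_from_nat.comp hκ') (fun t => neg_one_pow_eq_or ℝ _) hq
    (neg_one_pow_eq_or ℝ k)

/-- A dyadic partition scheme on a set `F` along which the densities of the functionals `y n`
behave like Rademacher functions. -/
structure IsDyadicScheme {X : Type*} [NormedAddCommGroup X] [NormedSpace ℝ X]
    (b : (X →L[ℝ] ℝ) → ℝ → ℝ) (F : Set ℝ) (κ : ℕ → ℝ → ℕ) (y : ℕ → X →L[ℝ] ℝ) : Prop where
  measurable : ∀ n, Measurable (κ n)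
  lt : ∀ n t, κ n t < 2 ^ n
  succ : ∀ n t, κ (n + 1) t = 2 * κ n t ∨ κ (n + 1) t = 2 * κ n t + 1
  measure : ∀ n, ∀ k < 2 ^ n, mu.real (F ∩ {t | κ n t = k}) = mu.real F / 2 ^ n
  orthogonal : ∀ n m k, n ≤ m →
    ∫ t in F ∩ {t | κ m t = k}, (b (y n) t - (-1) ^ κ n t) ∂mu = 0

theorem exists_isDyadicScheme {X : Type*} [NormedAddCommGroup X] [NormedSpace ℝ X]
    {T : Lp ℝ 1 mu →L[ℝ] X} (hT : ¬ CompletelyContinuous T)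
    {b : (X →L[ℝ] ℝ) → ℝ → ℝ} (hb : IsDensity T b) :
    ∃ (F : Set ℝ) (C : ℝ) (κ : ℕ → ℝ → ℕ) (y : ℕ → X →L[ℝ] ℝ), MeasurableSet F ∧ mu F ≠ 0 ∧
      (∀ n, ‖y n‖ ≤ C) ∧ IsDyadicScheme b F κ y := by
  obtain ⟨E, C, hE, hE0, hstage⟩ := exists_stage hT hb
  obtain ⟨y₀, φ, hy₀, hφm, hφ1, hφh, hby₀, hφb⟩ := hstage (K := Unit) (ι := Unit) (fun _ => E)
    (fun _ _ => 1) (fun _ => hE) (fun _ => subset_rfl) (fun i j hij => (hij rfl).elim)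
    (fun _ => integrable_const 1)
  have hφh := hφh () ()
  have hby₀ := hby₀ ()
  have hφb := hφb ()
  set F : Set ℝ := E ∩ {t | φ t = 1} with hF_def
  have hF : MeasurableSet F := hE.inter (hφm (measurableSet_singleton 1))
  have hsign_int {κ : ℝ → ℕ} (hκ : Measurable κ) {q : ℝ → ℝ} (hq : Integrable q mu) :
      Integrable (fun t => (-1 : ℝ) ^ κ t * q t) mu :=
    integrable_mul_of_bounded (g := fun t => (-1 : ℝ) ^ κ t) (R := 1)
      (measurable_from_nat.comp hκ) (fun t => by simp) hq
  have hu_int {κ : ℝ → ℕ} (hκ : Measurable κ) (y : X →L[ℝ] ℝ) :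
      Integrable (fun t => b y t - (-1 : ℝ) ^ κ t) mu :=
    (hb.integrable y).sub (by simpa using hsign_int hκ (integrable_const 1))
  have hFE : mu.real F = mu.real E / 2 := by
    have := setIntegral_inter_sign (μ := mu) (S := E) hφm hφ1 (integrable_const (1 : ℝ))
      (s := 1) (Or.inl rfl)
    rw [hφh] at this
    simpa using this
  have hF0 : mu F ≠ 0 := by
    have h1 : mu.real E ≠ 0 := (measureReal_ne_zero_iff).2 hE0
    refine (measureReal_ne_zero_iff (measure_ne_top _ _)).1 ?_
    rw [hFE]
    positivity
  have hu₀ : ∫ t in F, (b y₀ t - 1) ∂mu = 0 := by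
    rw [integral_sub (hb.integrable y₀).integrableOn (integrable_const _),
      setIntegral_inter_sign hφm hφ1 (hb.integrable y₀) (Or.inl rfl), hby₀, hφb]
    simp [hFE]
  let Inv (n : ℕ) (s : (ℝ → ℕ) × Set (ℝ → ℝ) × (X →L[ℝ] ℝ)) : Prop :=
    Measurable s.1 ∧ (∀ t, s.1 t < 2 ^ n) ∧ s.2.1.Finite ∧ (∀ h ∈ s.2.1, Integrable h mu) ∧
      (fun _ => 1) ∈ s.2.1 ∧ (fun t => b s.2.2 t - (-1 : ℝ) ^ s.1 t) ∈ s.2.1 ∧ ‖s.2.2‖ ≤ C ∧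
      ∀ k, ∫ t in F ∩ {t | s.1 t = k}, (b s.2.2 t - (-1 : ℝ) ^ s.1 t) ∂mu = 0
  let Step (s s' : (ℝ → ℕ) × Set (ℝ → ℝ) × (X →L[ℝ] ℝ)) : Prop :=
    (∀ t, s'.1 t = 2 * s.1 t ∨ s'.1 t = 2 * s.1 t + 1) ∧ s.2.1 ⊆ s'.2.1 ∧
      ∀ k, ∀ h ∈ s.2.1, ∫ t in F ∩ {t | s.1 t = k}, (-1 : ℝ) ^ s'.1 t * h t ∂mu = 0
  have hinit : ∃ s, Inv 0 s := by
    refine ⟨(fun _ => 0, {(fun _ => 1), (fun t => b y₀ t - (-1 : ℝ) ^ 0)}, y₀), measurable_const,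
      by simp, by simp, ?_, by simp, by simp, hy₀, fun k => ?_⟩
    · rintro h (rfl | rfl)
      · exact integrable_const 1
      · exact hu_int (κ := fun _ => 0) measurable_const y₀
    · by_cases hk : 0 = k
      · subst hk
        simpa using hu₀
      · simp [hk]
  have hnext (n : ℕ) (s : {s // Inv n s}) : ∃ s' : {s // Inv (n + 1) s}, Step s s' := by
    obtain ⟨⟨κ, H, y⟩, hκ, hκn, hHf, hHi, hH1, hHu, hyC, hu0⟩ := s
    simp only at hκ hκn hHf hHi hH1 hHu hyC hu0
    have := hHf.to_subtype
    obtain ⟨y', ψ, hy'C, hψm, hψ1, hψh, hby', hψb⟩ := hstage (K := Fin (2 ^ n)) (ι := H)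
      (fun k => F ∩ {t | κ t = k}) (fun h => h.1)
      (fun k => hF.inter (hκ (measurableSet_singleton _)))
      (fun k => Set.inter_subset_left.trans Set.inter_subset_left)
      (fun i j hij => Set.disjoint_left.2 fun t hi hj => hij (Fin.ext (hi.2.symm.trans hj.2)))
      (fun h => hHi _ h.2)
    set κ' : ℝ → ℕ := fun t => 2 * κ t + if ψ t = 1 then 0 else 1 with hκ'
    have hκ'm : Measurable κ' := by
      refine (hκ.const_mul 2).add (Measurable.ite ?_ measurable_const measurable_const)
      exact hψm (measurableSet_singleton 1)
    have hκ'step (t : ℝ) : κ' t = 2 * κ t ∨ κ' t = 2 * κ t + 1 := by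
      simp only [hκ']
      split_ifs
      · exact Or.inl rfl
      · exact Or.inr rfl
    have hκ'ψ (t : ℝ) : (-1 : ℝ) ^ κ' t = ψ t := by
      simp only [hκ', pow_add, pow_mul]
      rcases hψ1 t with h | h
      · simp [h]
      · rw [h]
        norm_num
    have hempty {k : ℕ} (hk : ¬ k < 2 ^ n) : F ∩ {t | κ t = k} = ∅ := by
      refine Set.eq_empty_of_forall_notMem fun t ht => hk ?_
      rw [← (ht.2 : κ t = k)]
      exact hκn t
    set u' : ℝ → ℝ := fun t => b y' t - (-1 : ℝ) ^ κ' t with hu'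
    have hu'i : Integrable u' mu := hu_int hκ'm y'
    have hψ0 (k : ℕ) (h : ℝ → ℝ) (hh : h ∈ H) :
        ∫ t in F ∩ {t | κ t = k}, (-1 : ℝ) ^ κ' t * h t ∂mu = 0 := by
      by_cases hk : k < 2 ^ n
      · simp only [hκ'ψ]
        exact hψh ⟨k, hk⟩ ⟨h, hh⟩
      · rw [hempty hk, setIntegral_empty]
    have hψi : Integrable ψ mu := by
      simpa [hκ'ψ] using hsign_int hκ'm (integrable_const (1 : ℝ))
    have hψ00 (k : ℕ) : ∫ t in F ∩ {t | κ t = k}, ψ t ∂mu = 0 := by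
      simpa [hκ'ψ] using hψ0 k _ hH1
    have hu'0 (k : ℕ) : ∫ t in F ∩ {t | κ t = k}, u' t ∂mu = 0 := by
      by_cases hk : k < 2 ^ n
      · simp only [hu', hκ'ψ]
        rw [integral_sub (hb.integrable y').integrableOn hψi.integrableOn, hψ00, sub_zero]
        exact hby' ⟨k, hk⟩
      · rw [hempty hk, setIntegral_empty]
    have hψu'0 (k : ℕ) : ∫ t in F ∩ {t | κ t = k}, (-1 : ℝ) ^ κ' t * u' t ∂mu = 0 := by
      by_cases hk : k < 2 ^ n
      · have h1 (t : ℝ) : (-1 : ℝ) ^ κ' t * u' t = ψ t * b y' t - 1 := by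
          simp only [hu', hκ'ψ]
          rcases hψ1 t with h | h <;> rw [h] <;> ring
        simp only [h1]
        have h2 : Integrable (fun t => ψ t * b y' t) mu := by
          simpa [hκ'ψ] using hsign_int hκ'm (hb.integrable y')
        rw [integral_sub h2.integrableOn (integrable_const _)]
        have h3 := hψb ⟨k, hk⟩
        simp only at h3
        rw [h3]
        simp
      · rw [hempty hk, setIntegral_empty]
    refine ⟨⟨(κ', insert u' H, y'), hκ'm, fun t => ?_, hHf.insert _, ?_, Set.mem_insert_of_mem _ hH1,
      Set.mem_insert _ _, hy'C, fun k => ?_⟩, hκ'step, Set.subset_insert _ _, hψ0⟩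
    · have h1 := hκn t
      have h2 := hκ'step t
      rw [pow_succ]
      simp only
      omega
    · rintro h (rfl | hh)
      · exact hu'i
      · exact hHi h hh
    · change ∫ t in F ∩ {t | κ' t = k}, u' t ∂mu = 0
      rw [setIntegral_dyadic_child hκ'm hu'i hκ'step, hu'0, hψu'0]
      simp
  obtain ⟨s₀, hs₀⟩ := hinit
  choose next hnext using hnext
  let s (n : ℕ) : {s // Inv n s} := Nat.rec ⟨s₀, hs₀⟩ next n
  have hs (n : ℕ) : Step (s n).1 (s (n + 1)).1 := hnext n (s n)
  have hH {n m : ℕ} (hnm : n ≤ m) : (s n).1.2.1 ⊆ (s m).1.2.1 := by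
    induction m, hnm using Nat.le_induction with
    | base => exact subset_rfl
    | succ m _ ih => exact ih.trans (hs m).2.1
  refine ⟨F, C, fun n => (s n).1.1, fun n => (s n).1.2.2, hF, hF0, fun n => (s n).2.2.2.2.2.2.2.1,
    fun n => (s n).2.1, fun n => (s n).2.2.1, fun n => (hs n).1, fun n => ?_, fun n m k hnm => ?_⟩
  · induction n with
    | zero =>
      intro k hk
      have h0 (t : ℝ) : (s 0).1.1 t = 0 := by simpa using (s 0).2.2.1 t
      have hk0 : k = 0 := by simpa using hk
      simp [h0, hk0]
    | succ n ih =>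
      intro k hk
      have h1 := setIntegral_dyadic_child (F := F) (s (n + 1)).2.1
        (integrable_const (μ := mu) (1 : ℝ)) (hs n).1 k
      rw [(hs n).2.2 _ _ (s n).2.2.2.2.2.1] at h1
      simp only [integral_const, smul_eq_mul, mul_one, mul_zero, add_zero, measureReal_restrict_apply,
        MeasurableSet.univ, Set.univ_inter] at h1
      rw [h1, ih (k / 2) (by rw [pow_succ] at hk; omega), pow_succ, div_div]
  · induction m, hnm using Nat.le_induction generalizing k with
    | base => exact (s n).2.2.2.2.2.2.2.2 k
    | succ m hm ih =>
      have hmem := hH hm (s n).2.2.2.2.2.2.1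
      rw [setIntegral_dyadic_child (s (m + 1)).2.1 ((s m).2.2.2.2.1 _ hmem) (hs m).1,
        ih, (hs m).2.2 _ _ hmem]
      simp

theorem integral_mul_comp_eq_sum {Ω : Type*} [MeasurableSpace Ω] {ν : Measure Ω} {κ : Ω → ℕ}
    {N : ℕ} (hκ : Measurable κ) (hN : ∀ᵐ ω ∂ν, κ ω < N) {q : Ω → ℝ} (hq : Integrable q ν)
    (G : ℕ → ℝ) :
    ∫ ω, q ω * G (κ ω) ∂ν = ∑ k ∈ Finset.range N, G k * ∫ ω in {ω | κ ω = k}, q ω ∂ν := by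
  have hm (k : ℕ) : MeasurableSet {ω | κ ω = k} := hκ (measurableSet_singleton k)
  simp only [← integral_indicator (hm _), ← integral_const_mul]
  rw [← integral_finsetSum _ fun k _ => (hq.indicator (hm k)).const_mul (G k)]
  refine integral_congr_ae ?_
  filter_upwards [hN] with ω hω
  rw [Finset.sum_eq_single (κ ω)]
  · simp [mul_comm]
  · intro k _ hk
    simp [hk.symm]
  · simp [hω]

theorem ae_lt_of_measureReal_eq {Ω : Type*} [MeasurableSpace Ω] {ν : Measure Ω}
    [IsProbabilityMeasure ν] {κ : Ω → ℕ} {n : ℕ} (hκ : Measurable κ)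
    (hν : ∀ k < 2 ^ n, ν.real {ω | κ ω = k} = 1 / 2 ^ n) : ∀ᵐ ω ∂ν, κ ω < 2 ^ n := by
  have hm : MeasurableSet {ω | κ ω < 2 ^ n} := hκ (measurableSet_Iio (a := 2 ^ n))
  have hU : {ω | κ ω < 2 ^ n} = ⋃ k ∈ Finset.range (2 ^ n), {ω | κ ω = k} := by
    ext ω
    simp
  have h1 : ν.real {ω | κ ω < 2 ^ n} = 1 := by
    rw [hU, measureReal_biUnion_finset (f := fun k => {ω | κ ω = k})
      (fun i _ j _ hij => Set.disjoint_left.2 fun ω hi hj => hij (hi.symm.trans hj))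
      fun k _ => hκ (measurableSet_singleton k),
      Finset.sum_congr rfl fun k hk => hν k (Finset.mem_range.1 hk)]
    simp
  have h2 : ν {ω | κ ω < 2 ^ n} = 1 := by
    rwa [measureReal_def, ENNReal.toReal_eq_one_iff] at h1
  exact (prob_compl_eq_zero_iff hm).2 h2

/-- Averages against a dyadic partition scheme converge to a limit that depends only on the law of
the scheme. -/
theorem tendsto_sum_dyadic {Ω : Type*} [MeasurableSpace Ω] {ν : Measure Ω}
    [IsProbabilityMeasure ν] {κ : ℕ → Ω → ℕ} {τ : Ω → ℝ} (hκ : ∀ n, Measurable (κ n))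
    (hν : ∀ n, ∀ k < 2 ^ n, ν.real {ω | κ n ω = k} = 1 / 2 ^ n)
    (hdiv : ∀ n m ω, n ≤ m → κ n ω = κ m ω / 2 ^ (m - n))
    (hlim : ∀ᵐ ω ∂ν, Tendsto (fun m => (κ m ω : ℝ) / 2 ^ m) atTop (𝓝 (τ ω)))
    (n : ℕ) {s : ℕ → ℝ} (hs : ∀ k, |s k| ≤ 1) (f : BoundedContinuousFunction ℝ ℝ) :
    Tendsto (fun m => ∑ k ∈ Finset.range (2 ^ m),
        s (k / 2 ^ (m - n)) * f ((k : ℝ) / 2 ^ m) * (1 / 2 ^ m)) atTop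
      (𝓝 (∫ ω, s (κ n ω) * f (τ ω) ∂ν)) := by
  have hsm : Measurable fun ω => s (κ n ω) := measurable_from_nat.comp (hκ n)
  have hfm (m : ℕ) : Measurable fun ω => f ((κ m ω : ℝ) / 2 ^ m) :=
    (measurable_from_nat (f := fun k : ℕ => f ((k : ℝ) / 2 ^ m))).comp (hκ m)
  have h1 : Tendsto (fun m => ∫ ω, s (κ n ω) * f ((κ m ω : ℝ) / 2 ^ m) ∂ν) atTop
      (𝓝 (∫ ω, s (κ n ω) * f (τ ω) ∂ν)) := by
    refine tendsto_integral_of_dominated_convergence (fun _ => ‖f‖)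
      (fun m => (hsm.mul (hfm m)).aestronglyMeasurable) (integrable_const _)
      (fun m => Eventually.of_forall fun ω => ?_) ?_
    · rw [norm_mul]
      exact (mul_le_of_le_one_left (norm_nonneg _) (hs _)).trans (f.norm_coe_le_norm _)
    · filter_upwards [hlim] with ω hω
      exact ((f.continuous.tendsto _).comp hω).const_mul _
  refine h1.congr' ?_
  filter_upwards [eventually_ge_atTop n] with m hm
  have h2 := integral_mul_comp_eq_sum (hκ m) (ae_lt_of_measureReal_eq (hκ m) (hν m))
    (integrable_const (μ := ν) (1 : ℝ)) fun k => s (k / 2 ^ (m - n)) * f ((k : ℝ) / 2 ^ m)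
  simp only [one_mul, ← hdiv n m _ hm] at h2
  rw [h2]
  refine Finset.sum_congr rfl fun k hk => ?_
  simp [hν m k (Finset.mem_range.1 hk)]

theorem natFloor_two_pow_mul_eq_div (n m : ℕ) (hnm : n ≤ m) (t : ℝ) :
    ⌊(2 : ℝ) ^ n * t⌋₊ = ⌊(2 : ℝ) ^ m * t⌋₊ / 2 ^ (m - n) := by
  rw [← Nat.floor_div_natCast]
  congr 1
  rw [eq_div_iff (by positivity)]
  push_cast
  rw [mul_right_comm, ← pow_add, Nat.add_sub_cancel' hnm]

theorem measureReal_natFloor_eq (n k : ℕ) (hk : k < 2 ^ n) :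
    mu.real {t : ℝ | ⌊(2 : ℝ) ^ n * t⌋₊ = k} = 1 / 2 ^ n := by
  have hp : (0 : ℝ) < 2 ^ n := by positivity
  have hk' : (k : ℝ) + 1 ≤ 2 ^ n := by exact_mod_cast hk
  have hset : {t : ℝ | ⌊(2 : ℝ) ^ n * t⌋₊ = k} ∩ Set.Icc 0 1 =
      Set.Ico ((k : ℝ) / 2 ^ n) ((k + 1) / 2 ^ n) := by
    ext t
    simp only [Set.mem_inter_iff, Set.mem_ofPred_eq, Set.mem_Icc, Set.mem_Ico]
    rw [div_le_iff₀ hp, lt_div_iff₀ hp, mul_comm t]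
    constructor
    · rintro ⟨h1, h2, h3⟩
      exact (Nat.floor_eq_iff (by positivity)).1 h1
    · rintro ⟨h1, h2⟩
      have h0 : 0 ≤ (2 : ℝ) ^ n * t := (Nat.cast_nonneg k).trans h1
      refine ⟨(Nat.floor_eq_iff h0).2 ⟨h1, h2⟩, nonneg_of_mul_nonneg_right h0 hp, ?_⟩
      by_contra! h
      nlinarith
  have hm : MeasurableSet {t : ℝ | ⌊(2 : ℝ) ^ n * t⌋₊ = k} :=
    (Nat.measurable_floor.comp (measurable_const_mul _)) (measurableSet_singleton k)
  rw [mu, measureReal_restrict_apply hm, hset, Real.volume_real_Ico, max_eq_left]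
  · ring
  · rw [← sub_div]
    simp

theorem tendsto_natFloor_two_pow_mul_div {t : ℝ} (ht : 0 ≤ t) :
    Tendsto (fun m : ℕ => (⌊(2 : ℝ) ^ m * t⌋₊ : ℝ) / 2 ^ m) atTop (𝓝 t) := by
  have h := (tendsto_nat_floor_mul_div_atTop ht).comp
    (tendsto_pow_atTop_atTop_of_one_lt (one_lt_two (α := ℝ)))
  refine h.congr fun m => ?_
  simp [mul_comm]

theorem MeasureTheory.MeasurePreserving.integral_comp_of_aestronglyMeasurable
    {Ω Ω' : Type*} [MeasurableSpace Ω] [MeasurableSpace Ω'] {ν : Measure Ω} {ν' : Measure Ω'}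
    {τ : Ω → Ω'} (hτ : MeasurePreserving τ ν ν') {g : Ω' → ℝ} (hg : AEStronglyMeasurable g ν') :
    ∫ ω, g (τ ω) ∂ν = ∫ x, g x ∂ν' := by
  rw [← hτ.map_eq] at hg ⊢
  exact (integral_map hτ.aemeasurable hg).symm

theorem exists_linearIsometry_comp {F : Set ℝ} (hF : MeasurableSet F) (hF0 : mu F ≠ 0)
    {τ : ℝ → ℝ} (hτ : MeasurePreserving τ ((mu F)⁻¹ • mu.restrict F) mu) :
    ∃ A : Lp ℝ 1 mu →ₗᵢ[ℝ] Lp ℝ 1 mu, ∀ (f : Lp ℝ 1 mu) (q : ℝ → ℝ),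
      ∫ t, q t * A f t ∂mu = ∫ t, q t * f (τ t) ∂((mu F)⁻¹ • mu.restrict F) := by
  set P := (mu F)⁻¹ • mu.restrict F with hP
  set c : ℝ := (mu.real F)⁻¹ with hc
  have hc0 : 0 ≤ c := inv_nonneg.2 measureReal_nonneg
  have hinv : (mu F)⁻¹ ≠ 0 := ENNReal.inv_ne_zero.2 (measure_ne_top _ _)
  have hinv' : (mu F)⁻¹ ≠ ⊤ := ENNReal.inv_ne_top.2 hF0
  have hae {p : ℝ → Prop} (hp : ∀ᵐ t ∂mu, p t) : ∀ᵐ t ∂mu, t ∈ F → p (τ t) := by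
    have h1 : ∀ᵐ t ∂P, p (τ t) := hτ.quasiMeasurePreserving.ae hp
    rw [hP, Measure.ae_ennreal_smul_measure_iff hinv] at h1
    exact (ae_restrict_iff' hF).1 h1
  have hPint (q : ℝ → ℝ) : ∫ t, q t ∂P = ∫ t, c * F.indicator q t ∂mu := by
    rw [hP, integral_smul_measure, integral_const_mul, integral_indicator hF, ENNReal.toReal_inv]
    rfl
  set a : Lp ℝ 1 mu → ℝ → ℝ := fun f t => c * F.indicator (fun t => f (τ t)) t with ha
  have hai (f : Lp ℝ 1 mu) : Integrable (a f) mu := by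
    have h1 : Integrable (fun t => f (τ t)) P :=
      (hτ.integrable_comp (Lp.stronglyMeasurable f).aestronglyMeasurable).2 (L1.integrable_coeFn f)
    rw [hP, integrable_smul_measure hinv hinv'] at h1
    exact ((integrable_indicator_iff hF).2 h1).const_mul c
  let L : Lp ℝ 1 mu →ₗ[ℝ] Lp ℝ 1 mu :=
    { toFun := fun f => (hai f).toL1 (a f)
      map_add' := fun f g => by
        rw [← Integrable.toL1_add, Integrable.toL1_eq_toL1_iff]
        filter_upwards [hae (Lp.coeFn_add f g)] with t ht
        by_cases htF : t ∈ F
        · simp only [ha, htF, ht htF, Set.indicator_of_mem, Pi.add_apply, mul_add]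
        · simp [ha, htF]
      map_smul' := fun r f => by
        rw [RingHom.id_apply, ← Integrable.toL1_smul', Integrable.toL1_eq_toL1_iff]
        filter_upwards [hae (Lp.coeFn_smul r f)] with t ht
        by_cases htF : t ∈ F
        · simp only [ha, htF, ht htF, Set.indicator_of_mem, Pi.smul_apply, smul_eq_mul]
          ring
        · simp [ha, htF] }
  refine ⟨⟨L, fun f => ?_⟩, fun f q => ?_⟩
  · rw [L1.norm_eq_integral_norm, L1.norm_eq_integral_norm]
    rw [← hτ.integral_comp_of_aestronglyMeasurable
      (Lp.stronglyMeasurable f).norm.aestronglyMeasurable, hPint]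
    refine integral_congr_ae ?_
    filter_upwards [(hai f).coeFn_toL1] with t ht
    change ‖((hai f).toL1 (a f)) t‖ = _
    rw [ht]
    by_cases htF : t ∈ F
    · simp [ha, htF, abs_of_nonneg hc0]
    · simp [ha, htF]
  · rw [hPint]
    refine integral_congr_ae ?_
    filter_upwards [(hai f).coeFn_toL1] with t ht
    change q t * ((hai f).toL1 (a f)) t = _
    rw [ht]
    by_cases htF : t ∈ F
    · simp only [ha, htF, Set.indicator_of_mem]
      ring
    · simp [ha, htF]

theorem exists_clm_lp_infty {X : Type*} [NormedAddCommGroup X] [NormedSpace ℝ X]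
    {y : ℕ → X →L[ℝ] ℝ} {C : ℝ} (hy : ∀ n, ‖y n‖ ≤ C) :
    ∃ B : X →L[ℝ] lp (fun _ : ℕ => ℝ) ⊤, ∀ x n, B x n = y n x := by
  have hC : 0 ≤ C := (norm_nonneg _).trans (hy 0)
  have hb (x : X) (n : ℕ) : ‖y n x‖ ≤ C * ‖x‖ :=
    ((y n).le_opNorm x).trans (mul_le_mul_of_nonneg_right (hy n) (norm_nonneg x))
  have hmem (x : X) : Memℓp (fun n => y n x) ⊤ :=
    memℓp_infty ⟨C * ‖x‖, by rintro _ ⟨n, rfl⟩; exact hb x n⟩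
  let L : X →ₗ[ℝ] lp (fun _ : ℕ => ℝ) ⊤ :=
    { toFun := fun x => ⟨fun n => y n x, hmem x⟩
      map_add' := fun x z => by ext n; exact map_add (y n) x z
      map_smul' := fun r x => by ext n; exact map_smul (y n) r x }
  exact ⟨L.mkContinuous C fun x => lp.norm_le_of_forall_le (by positivity) (hb x), fun x n => rfl⟩

theorem IsDyadicScheme.div {X : Type*} [NormedAddCommGroup X] [NormedSpace ℝ X]
    {b : (X →L[ℝ] ℝ) → ℝ → ℝ} {F : Set ℝ} {κ : ℕ → ℝ → ℕ} {y : ℕ → X →L[ℝ] ℝ}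
    (hs : IsDyadicScheme b F κ y) (n m : ℕ) (t : ℝ) (hnm : n ≤ m) :
    κ n t = κ m t / 2 ^ (m - n) := by
  induction m, hnm using Nat.le_induction with
  | base => simp
  | succ m hm ih =>
    rw [Nat.succ_sub hm, pow_succ', ← Nat.div_div_eq_div_mul, ih]
    congr 1
    have := hs.succ m t
    omega

theorem IsDyadicScheme.exists_tendsto {X : Type*} [NormedAddCommGroup X] [NormedSpace ℝ X]
    {b : (X →L[ℝ] ℝ) → ℝ → ℝ} {F : Set ℝ} {κ : ℕ → ℝ → ℕ} {y : ℕ → X →L[ℝ] ℝ}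
    (hs : IsDyadicScheme b F κ y) :
    ∃ τ : ℝ → ℝ, Measurable τ ∧
      ∀ t, Tendsto (fun m => (κ m t : ℝ) / 2 ^ m) atTop (𝓝 (τ t)) := by
  have h1 (t : ℝ) : ∃ x, Tendsto (fun m => (κ m t : ℝ) / 2 ^ m) atTop (𝓝 x) := by
    refine ⟨_, tendsto_atTop_ciSup (monotone_nat_of_le_succ fun m => ?_) ⟨1, ?_⟩⟩
    · have h2 : 2 * κ m t ≤ κ (m + 1) t := by
        have := hs.succ m t
        omega
      have h3 : 2 * (κ m t : ℝ) ≤ κ (m + 1) t := by exact_mod_cast h2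
      rw [div_le_div_iff₀ (by positivity) (by positivity), pow_succ]
      nlinarith [pow_pos (two_pos (α := ℝ)) m]
    · rintro _ ⟨m, rfl⟩
      refine (div_le_one (by positivity)).2 ?_
      exact_mod_cast (hs.lt m t).le
  choose τ hτ using h1
  refine ⟨τ, measurable_of_tendsto_metrizable (fun m => ?_) (tendsto_pi_nhds.2 hτ), hτ⟩
  exact (measurable_from_nat (f := fun k : ℕ => (k : ℝ) / 2 ^ m)).comp (hs.measurable m)

theorem IsDyadicScheme.setIntegral_mul_eq_zero {X : Type*} [NormedAddCommGroup X]
    [NormedSpace ℝ X] {T : Lp ℝ 1 mu →L[ℝ] X} {b : (X →L[ℝ] ℝ) → ℝ → ℝ} (hb : IsDensity T b)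
    {F : Set ℝ} {κ : ℕ → ℝ → ℕ} {y : ℕ → X →L[ℝ] ℝ} (hs : IsDyadicScheme b F κ y) {τ : ℝ → ℝ}
    (hτ : ∀ t, Tendsto (fun m => (κ m t : ℝ) / 2 ^ m) atTop (𝓝 (τ t))) (n : ℕ)
    (f : BoundedContinuousFunction ℝ ℝ) :
    ∫ t in F, (b (y n) t - (-1) ^ κ n t) * f (τ t) ∂mu = 0 := by
  set u : ℝ → ℝ := fun t => b (y n) t - (-1) ^ κ n t with hu
  have hum : Measurable u :=
    (hb.measurable _).sub ((measurable_from_nat (f := fun k => (-1 : ℝ) ^ k)).comp (hs.measurable n))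
  have hub (t : ℝ) : |u t| ≤ ‖y n‖ * ‖T‖ + 1 :=
    (abs_sub _ _).trans (add_le_add (hb.bound _ t) (by simp))
  have hui : Integrable u mu :=
    Integrable.of_bound hum.aestronglyMeasurable _ (Eventually.of_forall hub)
  have h1 : Tendsto (fun m => ∫ t in F, u t * f ((κ m t : ℝ) / 2 ^ m) ∂mu) atTop
      (𝓝 (∫ t in F, u t * f (τ t) ∂mu)) := by
    refine tendsto_integral_of_dominated_convergence (fun _ => (‖y n‖ * ‖T‖ + 1) * ‖f‖)
      (fun m => (hum.mul ?_).aestronglyMeasurable) (integrable_const _)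
      (fun m => Eventually.of_forall fun t => ?_) (Eventually.of_forall fun t => ?_)
    · exact (measurable_from_nat (f := fun k : ℕ => f ((k : ℝ) / 2 ^ m))).comp (hs.measurable m)
    · rw [norm_mul]
      exact mul_le_mul (hub t) (f.norm_coe_le_norm _) (norm_nonneg _) (by positivity)
    · exact ((f.continuous.tendsto _).comp (hτ t)).const_mul _
  refine tendsto_nhds_unique h1 (tendsto_const_nhds.congr' ?_)
  filter_upwards [eventually_ge_atTop n] with m hm
  rw [integral_mul_comp_eq_sum (hs.measurable m) (Eventually.of_forall (hs.lt m)) hui.integrableOn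
    fun k : ℕ => f ((k : ℝ) / 2 ^ m)]
  refine (Finset.sum_eq_zero fun k _ => ?_).symm
  have hm' : MeasurableSet {t | κ m t = k} := hs.measurable m (measurableSet_singleton k)
  rw [Measure.restrict_restrict hm', Set.inter_comm, hs.orthogonal n m k hm, mul_zero]

theorem rademacher_eq_neg_one_pow {t : ℝ} (ht : 0 ≤ t) (n : ℕ) :
    rademacher n t = (-1) ^ ⌊(2 : ℝ) ^ n * t⌋₊ := by
  rw [rademacher, ← Int.natCast_floor_eq_floor (by positivity), zpow_natCast]

/-- If `T : L₁ → X` is a bounded linear operator into a Banach space `X` which is not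
completely continuous, then there exist a linear isometric embedding `A : L₁ → L₁` and a
bounded linear operator `B : X → ℓ∞` such that `B ∘ T ∘ A = T₀`, i.e.
`(B (T (A f)))_n = ∫ r_n f dμ` for every `f ∈ L₁` and every `n ≥ 0`. -/
theorem universal_factorization_ellInfty (X : Type*) [NormedAddCommGroup X] [NormedSpace ℝ X]
    [CompleteSpace X] (T : Lp ℝ 1 mu →L[ℝ] X) (hT : ¬ CompletelyContinuous T) :
    ∃ (A : Lp ℝ 1 mu →ₗᵢ[ℝ] Lp ℝ 1 mu) (B : X →L[ℝ] lp (fun _ : ℕ => ℝ) ⊤),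
      ∀ (f : Lp ℝ 1 mu) (n : ℕ), B (T (A f)) n = ∫ t, rademacher n t * f t ∂mu := by
  obtain ⟨b, hb⟩ := exists_isDensity T
  obtain ⟨F, C, κ, y, hF, hF0, hyC, hs⟩ := exists_isDyadicScheme hT hb
  obtain ⟨τ, hτm, hτ⟩ := hs.exists_tendsto
  set P := (mu F)⁻¹ • mu.restrict F with hP
  have hinv : (mu F)⁻¹ ≠ ⊤ := ENNReal.inv_ne_top.2 hF0
  have hFr : mu.real F ≠ 0 := (measureReal_ne_zero_iff (measure_ne_top _ _)).2 hF0
  have hPprob : IsProbabilityMeasure P :=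
    ⟨by simp [hP, ENNReal.inv_mul_cancel hF0 (measure_ne_top _ _)]⟩
  have hPmu {p : ℝ → Prop} (hp : ∀ᵐ t ∂mu, p t) : ∀ᵐ t ∂P, p t :=
    Measure.ae_smul_measure (ae_restrict_of_ae hp) _
  have hκP (n k : ℕ) (hk : k < 2 ^ n) : P.real {t | κ n t = k} = 1 / 2 ^ n := by
    have hm : MeasurableSet {t | κ n t = k} := hs.measurable n (measurableSet_singleton k)
    rw [hP, measureReal_ennreal_smul_apply, measureReal_restrict_apply hm, Set.inter_comm,
      hs.measure n k hk, ENNReal.toReal_inv, ← measureReal_def]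
    field_simp
  have hlaw (n : ℕ) {s : ℕ → ℝ} (hs1 : ∀ k, |s k| ≤ 1) (f : BoundedContinuousFunction ℝ ℝ) :
      ∫ t, s (κ n t) * f (τ t) ∂P = ∫ t, s ⌊(2 : ℝ) ^ n * t⌋₊ * f t ∂mu :=
    tendsto_nhds_unique
      (tendsto_sum_dyadic hs.measurable hκP (fun n m t hnm => hs.div n m t hnm)
        (Eventually.of_forall hτ) n hs1 f)
      (tendsto_sum_dyadic (κ := fun n (t : ℝ) => ⌊(2 : ℝ) ^ n * t⌋₊) (τ := fun t => t)
        (fun n => Nat.measurable_floor.comp (measurable_const_mul _)) measureReal_natFloor_eq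
        (fun n m t hnm => natFloor_two_pow_mul_eq_div n m hnm t)
        (ae_mem_Icc.mono fun t ht => tendsto_natFloor_two_pow_mul_div ht.1) n hs1 f)
  have hτP : MeasurePreserving τ P mu := by
    have : IsFiniteMeasure (P.map τ) := Measure.isFiniteMeasure_map P τ
    refine ⟨hτm, ext_of_forall_integral_eq_of_IsFiniteMeasure fun f => ?_⟩
    rw [integral_map hτm.aemeasurable f.continuous.aestronglyMeasurable]
    simpa using hlaw 0 (s := fun _ => 1) (by simp) f
  obtain ⟨A, hA⟩ := exists_linearIsometry_comp hF hF0 hτP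
  obtain ⟨B, hB⟩ := exists_clm_lp_infty hyC
  refine ⟨A, B, fun f n => ?_⟩
  have hrad : ∀ᵐ t ∂mu, rademacher n t = (-1) ^ ⌊(2 : ℝ) ^ n * t⌋₊ :=
    ae_mem_Icc.mono fun t ht => rademacher_eq_neg_one_pow ht.1 n
  obtain ⟨l, -, hl⟩ := exists_dual_of_bounded (μ := mu)
    (g := fun t : ℝ => (-1 : ℝ) ^ ⌊(2 : ℝ) ^ n * t⌋₊)
    ((measurable_from_nat (f := fun k => (-1 : ℝ) ^ k)).comp
      (Nat.measurable_floor.comp (measurable_const_mul _))) zero_le_one (fun t => by simp)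
  have hlrad : ∫ t, rademacher n t * f t ∂mu = l f := by
    rw [hl]
    refine integral_congr_ae ?_
    filter_upwards [hrad] with t ht
    rw [ht]
  rw [hB, hlrad]
  suffices h : (fun f => y n (T (A f))) = l from congrFun h f
  refine (BoundedContinuousFunction.toLp_denseRange ℝ mu ℝ ENNReal.one_ne_top).equalizer
    ((y n).continuous.comp (T.continuous.comp A.continuous)) l.continuous (funext fun f => ?_)
  have hf := BoundedContinuousFunction.coeFn_toLp (p := 1) (𝕜 := ℝ) mu f
  simp only [Function.comp_apply]
  have h1 : ∫ t, b (y n) t * f (τ t) ∂P = ∫ t, (-1) ^ κ n t * f (τ t) ∂P := by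
    have hfτ : Integrable (fun t => f (τ t)) P :=
      hτP.integrable_comp_of_integrable (f.integrable mu)
    rw [← sub_eq_zero, ← integral_sub
      (integrable_mul_of_bounded (hb.measurable _) (hb.bound _) hfτ)
      (integrable_mul_of_bounded (g := fun t => (-1 : ℝ) ^ κ n t) (R := 1)
        ((measurable_from_nat (f := fun k => (-1 : ℝ) ^ k)).comp (hs.measurable n)) (by simp) hfτ)]
    simp only [← sub_mul]
    rw [hP, integral_smul_measure, hs.setIntegral_mul_eq_zero hb hτ, smul_zero]
  calc y n (T (A (BoundedContinuousFunction.toLp 1 mu ℝ f)))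
      = ∫ t, b (y n) t * f (τ t) ∂P := by
        rw [hb.apply_eq, hA]
        refine integral_congr_ae ?_
        filter_upwards [hτP.quasiMeasurePreserving.ae hf] with t ht
        rw [ht]
    _ = ∫ t, (-1) ^ ⌊(2 : ℝ) ^ n * t⌋₊ * f t ∂mu := by
        rw [h1]
        exact hlaw n (s := fun k => (-1) ^ k) (by simp) f
    _ = l (BoundedContinuousFunction.toLp 1 mu ℝ f) := by
        rw [hl]
        refine integral_congr_ae ?_
        filter_upwards [hf] with t ht
        rw [ht]
end
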